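/- For every integer n > 2 there exists a finite dimensional k-algebra A with global dimension exactly n and a 2-term silting complex P in K^b(proj A) such that the endomorphism algebra End_{D^b(A)}(P) has infinite global dimension. -/

import Mathlib

/-!
Common setup: we model right `A`-modules as `ModuleCat Aᵐᵒᵖ`, the bounded derived
category `D^b(mod A)` as the full subcategory (given by the predicate `InDb`) of the
derived category of `Mod Aᵐᵒᵖ` consisting of cohomologically bounded complexes with
finitely generated cohomology, and `K^b(proj A)` via bounded complexes of finitely
generated projective modules (`IsPerfCplx`).
-/

namespace TwoTermSilting

open CategoryTheory Limits Pretriangulated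

universe w v u

noncomputable section

/-- The projective dimension of the module `M` is at most `n`. -/
def pdLE (R : Type u) [Ring R] : ℕ → ModuleCat.{v} R → Prop
  | 0, M => Projective M
  | (n+1), M => ∃ (P : ModuleCat.{v} R) (f : P ⟶ M),
      Projective P ∧ Epi f ∧ pdLE R n (kernel f)

/-- The (right) global dimension of `R` is at most `d`: every finitely generated
module has projective dimension at most `d`. -/
def gldLE (R : Type u) [Ring R] (d : ℕ) : Prop :=
  ∀ M : ModuleCat.{v} R, Module.Finite R M → pdLE R d M

section Star

variable {C : Type u} [Category.{v} C] [HasZeroObject C] [Preadditive C] [HasShift C ℤ]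
  [∀ n : ℤ, (shiftFunctor C n).Additive] [Pretriangulated C]

/-- `star S T` consists of the objects `Z` sitting in a distinguished triangle
`X ⟶ Z ⟶ Y ⟶ X⟦1⟧` with `X ∈ S` and `Y ∈ T`. -/
def star (S T : Set C) : Set C :=
  {Z | ∃ (X Y : C) (f : X ⟶ Z) (g : Z ⟶ Y) (h : Y ⟶ X⟦(1 : ℤ)⟧),
    X ∈ S ∧ Y ∈ T ∧ Triangle.mk f g h ∈ distTriang C}

/-- `starChain f n` is the iterated star product `f 0 * f 1 * ⋯ * f n`
(the star operation being associative). -/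
def starChain (f : ℕ → Set C) : ℕ → Set C
  | 0 => f 0
  | (n+1) => star (starChain f n) (f (n+1))

/-- The closure of a class of objects under the shift by `n`. -/
def shiftSet (S : Set C) (n : ℤ) : Set C :=
  {Y | ∃ X ∈ S, Nonempty (Y ≅ X⟦n⟧)}

/-- The additive closure of the object `X`: all direct summands of finite direct sums
of copies of `X`. -/
def addOf (X : C) : Set C :=
  {Y | ∃ (n : ℕ) (ι : Y ⟶ ⨁ (fun _ : Fin n => X)) (r : (⨁ (fun _ : Fin n => X)) ⟶ Y),
    ι ≫ r = 𝟙 Y}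

/-- A class of objects of a (pre)triangulated category is thick if it is closed under
isomorphisms, shifts, extensions and direct summands. -/
def IsThick (S : Set C) : Prop :=
  (∀ ⦃X Y : C⦄, (X ≅ Y) → X ∈ S → Y ∈ S) ∧
  (∀ (X : C) (n : ℤ), X ∈ S → (X⟦n⟧) ∈ S) ∧
  (∀ T : Triangle C, (T ∈ distTriang C) → T.obj₁ ∈ S → T.obj₃ ∈ S → T.obj₂ ∈ S) ∧
  (∀ (X Y : C) (ι : X ⟶ Y) (r : Y ⟶ X), ι ≫ r = 𝟙 X → Y ∈ S → X ∈ S)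

end Star

/-- The right `End Y`-module structure on `Y ⟶ X`, by precomposition. -/
instance endModule {C : Type u} [Category.{v} C] [Preadditive C] (Y X : C) :
    Module (End Y)ᵐᵒᵖ (Y ⟶ X) where
  smul b f := b.unop ≫ f
  one_smul f := Category.id_comp f
  mul_smul b₁ b₂ f := by
    show (b₁ * b₂).unop ≫ f = b₁.unop ≫ (b₂.unop ≫ f)
    have h : (b₁ * b₂).unop = b₁.unop ≫ b₂.unop := rfl
    rw [h, Category.assoc]
  smul_zero b := Limits.comp_zero
  smul_add b f g := Preadditive.comp_add _ _ _ _ _ _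
  add_smul b₁ b₂ f := Preadditive.add_comp _ _ _ _ _ _
  zero_smul f := Limits.zero_comp

section Main

variable (R : Type) [Ring R] [HasDerivedCategory.{w} (ModuleCat.{0} R)]

/-- A bounded complex of finitely generated projective modules
(an object of `K^b(proj R)`). -/
def IsPerfCplx (X : CochainComplex (ModuleCat.{0} R) ℤ) : Prop :=
  (∀ i, Projective (X.X i)) ∧ (∀ i, Module.Finite R (X.X i)) ∧
    ∃ a b : ℤ, ∀ i, (i < a ∨ b < i) → IsZero (X.X i)

/-- A complex of finitely generated projective modules concentrated in
degrees `-1` and `0`. -/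
def IsTwoTermCplx (X : CochainComplex (ModuleCat.{0} R) ℤ) : Prop :=
  (∀ i, Projective (X.X i)) ∧ (∀ i, Module.Finite R (X.X i)) ∧
    ∀ i, i ≠ -1 → i ≠ 0 → IsZero (X.X i)

/-- A two-term silting complex: a two-term complex of finitely generated projectives `P`
with `Hom_D(P, P[1]) = 0`, such that the smallest thick subcategory containing `P`
contains all of `K^b(proj R)`. -/
def IsTwoTermSilting (P : CochainComplex (ModuleCat.{0} R) ℤ) : Prop :=
  IsTwoTermCplx R P ∧
  (∀ f : DerivedCategory.Q.obj P ⟶ (DerivedCategory.Q.obj P)⟦(1 : ℤ)⟧, f = 0) ∧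
  (∀ S : Set (DerivedCategory (ModuleCat.{0} R)), IsThick S →
    DerivedCategory.Q.obj P ∈ S →
    ∀ X : CochainComplex (ModuleCat.{0} R) ℤ, IsPerfCplx R X → DerivedCategory.Q.obj X ∈ S)

/-- The objects of the derived category which belong to `D^b(mod R)`: cohomologically
bounded complexes with finitely generated cohomology. -/
def InDb (X : DerivedCategory (ModuleCat.{0} R)) : Prop :=
  (∃ a b : ℤ, ∀ i, (i < a ∨ b < i) →
    IsZero ((DerivedCategory.homologyFunctor (ModuleCat.{0} R) i).obj X)) ∧
  (∀ i : ℤ, Module.Finite R ((DerivedCategory.homologyFunctor (ModuleCat.{0} R) i).obj X))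

variable {R}

/-- The torsion class `T(P)` of finitely generated modules `X` with `Hom_D(P, X[1]) = 0`. -/
def TT (P : CochainComplex (ModuleCat.{0} R) ℤ) : Set (ModuleCat.{0} R) :=
  {X | Module.Finite R X ∧
    ∀ f : DerivedCategory.Q.obj P ⟶
      ((DerivedCategory.singleFunctor (ModuleCat.{0} R) 0).obj X)⟦(1 : ℤ)⟧, f = 0}

/-- The torsion-free class `F(P)` of finitely generated modules `Y` with `Hom_D(P, Y) = 0`. -/
def FF (P : CochainComplex (ModuleCat.{0} R) ℤ) : Set (ModuleCat.{0} R) :=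
  {Y | Module.Finite R Y ∧
    ∀ f : DerivedCategory.Q.obj P ⟶
      (DerivedCategory.singleFunctor (ModuleCat.{0} R) 0).obj Y, f = 0}

/-- The heart `C(P) = {X ∈ D^b(mod R) | Hom_D(P, X[i]) = 0 for all i ≠ 0}`. -/
def CP (P : CochainComplex (ModuleCat.{0} R) ℤ) : Set (DerivedCategory (ModuleCat.{0} R)) :=
  {X | InDb R X ∧ ∀ i : ℤ, i ≠ 0 → ∀ f : DerivedCategory.Q.obj P ⟶ X⟦i⟧, f = 0}

end Main

/-- A witness for Statement 2: a finite dimensional `k`-algebra `A` of global dimension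
exactly `n` together with a 2-term silting complex `P` in `K^b(proj A)` whose
endomorphism algebra has infinite global dimension. -/
structure SiltingWitness (k : Type) [Field k] (n : ℕ) where
  /-- the algebra -/
  A : Type
  [ringA : Ring A]
  [algA : Algebra k A]
  [finDimA : FiniteDimensional k A]
  [hasD : HasDerivedCategory.{1} (ModuleCat.{0} Aᵐᵒᵖ)]
  /-- the 2-term silting complex -/
  P : CochainComplex (ModuleCat.{0} Aᵐᵒᵖ) ℤ
  silting : IsTwoTermSilting Aᵐᵒᵖ P
  /-- `gl.dim A ≤ n` … -/
  gld_le : gldLE.{0, 0} Aᵐᵒᵖ n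
  /-- … and `gl.dim A` is not `≤ n - 1`, i.e. `gl.dim A = n` exactly -/
  gld_ge : ¬ gldLE.{0, 0} Aᵐᵒᵖ (n - 1)
  /-- the endomorphism algebra of `P` has infinite global dimension -/
  endo_infinite : ∀ m : ℕ, ¬ gldLE.{1, 1} (End (DerivedCategory.Q.obj P))ᵐᵒᵖ m

theorem pdLE_iff_hasProjectiveDimensionLT {R : Type u} [Ring R] [Small.{v} R] (d : ℕ) :
    ∀ M : ModuleCat.{v} R, pdLE R d M ↔ HasProjectiveDimensionLT M (d + 1) := by
  induction d with
  | zero => exact fun M => projective_iff_hasProjectiveDimensionLT_one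
  | succ d ih =>
    have key : ∀ {P M : ModuleCat.{v} R} (f : P ⟶ M) [Projective P] [Epi f],
        HasProjectiveDimensionLT M (d + 2) ↔ HasProjectiveDimensionLT (kernel f) (d + 1) := by
      intro P M f _ _
      have hS : (ShortComplex.mk (kernel.ι f) f (kernel.condition f)).ShortExact :=
        { exact := ShortComplex.exact_of_f_is_kernel _ (kernelIsKernel f) }
      exact hS.hasProjectiveDimensionLT_X₃_iff d ‹_›
    intro M
    constructor
    · rintro ⟨P, f, _, _, h⟩
      exact (key f).2 ((ih _).1 h)
    · intro h
      exact ⟨Projective.over M, Projective.π M, inferInstance, inferInstance,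
        (ih _).2 ((key _).1 h)⟩

/-- A cyclic left ideal `C x` which is its own syzygy and is not projective forces the global
dimension to be infinite. -/
theorem not_gldLE_of_periodic_cyclic {C : Type u} [Ring C] (x e : C) (hee : e * e = e)
    (hex : e * x = x) (hxe : x * e = x) (hxx : x * x = 0) (hx : x ≠ 0)
    (hker : ∀ c : C, c * e = c → c * x = 0 → ∃ d, c = d * x)
    (hxcx : ∀ c : C, x * c * x = 0) (m : ℕ) : ¬ gldLE.{u, u} C m := by
  intro H
  let Ce : Submodule C C := Submodule.span C {e}
  let Cx : Submodule C C := Submodule.span C {x}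
  have mem_e : ∀ c : C, c ∈ Ce ↔ c * e = c := fun c => by
    rw [Submodule.mem_span_singleton]
    constructor
    · rintro ⟨a, rfl⟩
      rw [smul_eq_mul, mul_assoc, hee]
    · exact fun h => ⟨c, h⟩
  have mem_x : ∀ c : C, c ∈ Cx ↔ ∃ d, d * x = c := fun c => Submodule.mem_span_singleton
  let ι : Cx →ₗ[C] Ce := Submodule.inclusion (by
    intro c hc
    obtain ⟨d, rfl⟩ := (mem_x c).1 hc
    rw [mem_e, mul_assoc, hxe])
  let π : Ce →ₗ[C] Cx :=
    ((LinearMap.toSpanSingleton C C x).comp Ce.subtype).codRestrict Cx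
      (fun c => (mem_x _).2 ⟨c.1, rfl⟩)
  have hπ : ∀ c : Ce, (π c : C) = c.1 * x := fun _ => rfl
  have hι : ∀ c : Cx, (ι c : C) = c.1 := fun _ => rfl
  have hexact : Function.Exact ι π := by
    intro c
    constructor
    · intro hc
      have hc' : c.1 * x = 0 := by rw [← hπ, hc]; rfl
      obtain ⟨d, hd⟩ := hker c.1 ((mem_e _).1 c.2) hc'
      exact ⟨⟨c.1, (mem_x _).2 ⟨d, hd.symm⟩⟩, rfl⟩
    · rintro ⟨y, rfl⟩
      apply Subtype.ext
      obtain ⟨d, hd⟩ := (mem_x _).1 y.2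
      rw [hπ, hι, ← hd, mul_assoc, hxx, mul_zero]; rfl
  have hsurj : Function.Surjective π := by
    intro y
    obtain ⟨d, hd⟩ := (mem_x _).1 y.2
    refine ⟨⟨d * e, (mem_e _).2 (by rw [mul_assoc, hee])⟩, Subtype.ext ?_⟩
    rw [hπ, ← hd, mul_assoc, hex]
  have hinj : Function.Injective ι := Submodule.inclusion_injective _
  have : Module.Projective C Ce :=
    Module.Projective.of_split Ce.subtype
      ((LinearMap.toSpanSingleton C C e).codRestrict Ce
        (fun c => Submodule.mem_span_singleton.2 ⟨c, rfl⟩))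
      (by ext c; exact (mem_e _).1 c.2)
  have hP : Projective (ModuleCat.of C Ce) := (IsProjective.iff_projective (R := C) Ce).1 this
  let S : ShortComplex (ModuleCat.{u} C) :=
    ShortComplex.mk (ModuleCat.ofHom ι) (ModuleCat.ofHom π)
      (by ext c; exact congrArg Subtype.val ((hexact _).2 ⟨c, rfl⟩))
  have hS : S.ShortExact := ModuleCat.shortComplex_shortExact S hexact hinj hsurj
  have descend : ∀ d : ℕ, HasProjectiveDimensionLT (ModuleCat.of C Cx) (d + 1) →
      HasProjectiveDimensionLT (ModuleCat.of C Cx) 1 := by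
    intro d
    induction d with
    | zero => exact id
    | succ d ih => exact fun h => ih ((hS.hasProjectiveDimensionLT_X₃_iff d hP).1 h)
  have hpr := descend m ((pdLE_iff_hasProjectiveDimensionLT m _).1
    (H (ModuleCat.of C Cx) (Module.Finite.span_singleton C x)))
  have hMP : Module.Projective C Cx :=
    (IsProjective.iff_projective (R := C) Cx).2
      (projective_iff_hasProjectiveDimensionLT_one.2 hpr)
  obtain ⟨s, hs⟩ := Module.projective_lifting_property π LinearMap.id hsurj
  let x' : Cx := ⟨x, (mem_x _).2 ⟨1, one_mul x⟩⟩
  have hyx : (s x' : C) * x = x := by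
    rw [← hπ]; exact congrArg Subtype.val (LinearMap.congr_fun hs x')
  have hxy : x * (s x' : C) = 0 := by
    have h0 : x • x' = 0 := Subtype.ext hxx
    have h1 : x • s x' = 0 := by rw [← map_smul, h0, map_zero]
    exact congrArg Subtype.val h1
  have hye : (s x' : C) * e = s x' := (mem_e _).1 (s x').2
  obtain ⟨d, hd⟩ := hker ((s x' : C) - e) (by rw [sub_mul, hye, hee])
    (by rw [sub_mul, hyx, hex, sub_self])
  apply hx
  have h2 : (s x' : C) = e + d * x := by rw [← hd]; abel
  rwa [h2, mul_add, hxe, ← mul_assoc, hxcx, add_zero] at hxy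

section TwoTerm

open CochainComplex HomComplex

variable {C : Type u} [Category.{v} C] [Abelian C]

/-- The complex vanishes outside the degrees `-1` and `0`. -/
def IsTwoTerm (K : CochainComplex C ℤ) : Prop := ∀ i, i ≠ -1 → i ≠ 0 → IsZero (K.X i)

theorem IsTwoTerm.isKProjective {K : CochainComplex C ℤ} (hK : IsTwoTerm K)
    (hP : ∀ i, Projective (K.X i)) : K.IsKProjective := by
  have : K.IsStrictlyLE 0 := (isStrictlyLE_iff K 0).2
    fun i hi => hK i (by omega) (by omega)
  exact isKProjective_of_projective K 0

theorem Q_map_surjective [HasDerivedCategory.{w} C] (K L : CochainComplex C ℤ) [K.IsKProjective] :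
    Function.Surjective (DerivedCategory.Q.map : (K ⟶ L) → _) := by
  intro f
  obtain ⟨g, hg⟩ := (IsKProjective.Qh_map_bijective K ((HomotopyCategory.quotient _ _).obj L)).2
    ((DerivedCategory.quotientCompQhIso C).hom.app K ≫ f ≫
      (DerivedCategory.quotientCompQhIso C).inv.app L)
  obtain ⟨c, rfl⟩ := (HomotopyCategory.quotient C (ComplexShape.up ℤ)).map_surjective g
  refine ⟨c, ?_⟩
  rw [← cancel_mono ((DerivedCategory.quotientCompQhIso C).inv.app L),
    DerivedCategory.quotientCompQhIso_inv_naturality, hg]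
  simp

theorem Q_map_eq_zero_iff [HasDerivedCategory.{w} C]
    {K L : CochainComplex C ℤ} [K.IsKProjective] (c : K ⟶ L) :
    DerivedCategory.Q.map c = 0 ↔ Nonempty (Homotopy c 0) := by
  constructor
  · intro h
    rw [← HomotopyCategory.quotient_map_eq_zero_iff]
    apply (IsKProjective.Qh_map_bijective K ((HomotopyCategory.quotient _ _).obj L)).1
    rw [← cancel_mono ((DerivedCategory.quotientCompQhIso C).hom.app L),
      DerivedCategory.quotientCompQhIso_hom_naturality, h]
    simp
  · rintro ⟨h⟩
    rw [DerivedCategory.Q_map_eq_of_homotopy C h, Functor.map_zero]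

theorem IsTwoTerm.homotopy_zero_iff {K L : CochainComplex C ℤ} (hK : IsTwoTerm K) (c : K ⟶ L)
    (hL : IsTwoTerm L) :
    Nonempty (Homotopy c 0) ↔ ∃ s : K.X 0 ⟶ L.X (-1),
      c.f (-1) = K.d (-1) 0 ≫ s ∧ c.f 0 = s ≫ L.d (-1) 0 := by
  rw [(Cochain.equivHomotopy c 0).nonempty_congr]
  constructor
  · rintro ⟨z, hz⟩
    rw [Cochain.ofHom_zero, add_zero] at hz
    refine ⟨z.v 0 (-1) (by simp), ?_, ?_⟩
    · have := Cochain.congr_v hz (-1) (-1) (by simp)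
      rw [Cochain.ofHom_v, δ_v (-1) 0 (by simp) z (-1) (-1) (by simp) (-2) 0 (by simp) (by simp),
        (hL (-2) (by simp) (by simp)).eq_of_tgt (z.v (-1) (-2) (by simp)) 0] at this
      simpa using this
    · have := Cochain.congr_v hz 0 0 (by simp)
      rw [Cochain.ofHom_v, δ_v (-1) 0 (by simp) z 0 0 (by simp) (-1) 1 (by simp) (by simp),
        (hK 1 (by simp) (by simp)).eq_of_src (z.v 1 0 (by simp)) 0] at this
      simpa using this
  · rintro ⟨s, h1, h0⟩
    refine ⟨Cochain.single s (-1), ?_⟩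
    rw [Cochain.ofHom_zero, add_zero, Cochain.δ_single s (-1) 0 (by simp) (-1) 0 (by simp)
      (by simp)]
    ext p
    rw [Cochain.ofHom_v]
    by_cases hp1 : p = -1
    · subst hp1
      simp [Cochain.single_v_eq_zero, h1]
    by_cases hp0 : p = 0
    · subst hp0
      simp [Cochain.single_v_eq_zero, h0]
    · exact (hK p hp1 hp0).eq_of_src _ _

theorem IsTwoTerm.hom_shift_eq_zero [HasDerivedCategory.{w} C]
    {K : CochainComplex C ℤ} (hK : IsTwoTerm K)
    [K.IsKProjective] (h : ∀ u : K.X (-1) ⟶ K.X 0, ∃ s, u = s ≫ K.d (-1) 0)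
    (f : DerivedCategory.Q.obj K ⟶ (DerivedCategory.Q.obj K)⟦(1 : ℤ)⟧) : f = 0 := by
  obtain ⟨c, hc⟩ := Q_map_surjective K (K⟦(1 : ℤ)⟧)
    (f ≫ (DerivedCategory.Q.commShiftIso (1 : ℤ)).inv.app K)
  have hf : f = DerivedCategory.Q.map c ≫ (DerivedCategory.Q.commShiftIso (1 : ℤ)).hom.app K := by
    rw [hc]; simp
  suffices hc0 : (HomotopyCategory.quotient C _).map c = 0 by
    rw [HomotopyCategory.quotient_map_eq_zero_iff] at hc0
    rw [hf, (Q_map_eq_zero_iff c).2 hc0, zero_comp]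
  obtain ⟨z, rfl⟩ := (Cocycle.equivHomShift (K := K) (L := K) (n := 1)).symm.surjective c
  rw [← CohomologyClass.toHom_mk, CohomologyClass.toHom_mk_eq_zero_iff,
    mem_coboundaries_iff _ 0 (by simp)]
  obtain ⟨s, hs⟩ := h (z.1.v (-1) 0 (by simp))
  refine ⟨Cochain.single s 0, ?_⟩
  rw [Cochain.δ_single s 0 1 (by simp) (-2) 0 (by simp) (by simp),
    (hK (-2) (by simp) (by simp)).eq_of_src (K.d (-2) (-1) ≫ s) 0]
  ext p q hpq
  by_cases hp1 : p = -1
  · subst hp1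
    obtain rfl : q = 0 := by omega
    simp [← hs]
  by_cases hp0 : p = 0
  · subst hp0
    exact (hK q (by omega) (by omega)).eq_of_tgt _ _
  · exact (hK p hp1 hp0).eq_of_src _ _

theorem double_rel : (ComplexShape.up ℤ).Rel (-1) 0 := by simp

theorem neg_one_ne_zero_int : (-1 : ℤ) ≠ 0 := by simp

/-- The two-term complex `X₀ ⟶ X₁` in degrees `-1` and `0`. -/
abbrev twoTerm {X₀ X₁ : C} (f : X₀ ⟶ X₁) : CochainComplex C ℤ :=
  HomologicalComplex.double f double_rel

variable {X₀ X₁ : C} (f : X₀ ⟶ X₁)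

theorem isTwoTerm_twoTerm : IsTwoTerm (twoTerm f) :=
  fun i h₁ h₀ => HomologicalComplex.isZero_double_X f double_rel i h₁ h₀

/-- The degree `-1` term of `twoTerm f`. -/
abbrev iso₀ : (twoTerm f).X (-1) ≅ X₀ := HomologicalComplex.doubleXIso₀ f double_rel

/-- The degree `0` term of `twoTerm f`. -/
abbrev iso₁ : (twoTerm f).X 0 ≅ X₁ :=
  HomologicalComplex.doubleXIso₁ f double_rel neg_one_ne_zero_int

theorem twoTerm_d : (twoTerm f).d (-1) 0 = (iso₀ f).hom ≫ f ≫ (iso₁ f).inv :=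
  HomologicalComplex.double_d f double_rel neg_one_ne_zero_int

theorem projective_twoTerm_X [Projective X₀] [Projective X₁] (i : ℤ) :
    Projective ((twoTerm f).X i) := by
  by_cases h1 : i = -1
  · subst h1; exact Projective.of_iso (iso₀ f).symm inferInstance
  by_cases h0 : i = 0
  · subst h0; exact Projective.of_iso (iso₁ f).symm inferInstance
  · have := (isTwoTerm_twoTerm f i h1 h0)
    exact Projective.of_iso this.isoZero.symm inferInstance

theorem isKProjective_twoTerm [Projective X₀] [Projective X₁] : (twoTerm f).IsKProjective :=
  (isTwoTerm_twoTerm f).isKProjective (projective_twoTerm_X f)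

theorem hom_twoTerm_shift_eq_zero [HasDerivedCategory.{w} C] [Projective X₀] [Projective X₁]
    (h : ∀ u : X₀ ⟶ X₁, ∃ s, u = s ≫ f)
    (g : DerivedCategory.Q.obj (twoTerm f) ⟶ (DerivedCategory.Q.obj (twoTerm f))⟦(1 : ℤ)⟧) :
    g = 0 := by
  have := isKProjective_twoTerm f
  refine (isTwoTerm_twoTerm f).hom_shift_eq_zero (fun u => ?_) g
  obtain ⟨s, hs⟩ := h ((iso₀ f).inv ≫ u ≫ (iso₁ f).hom)
  refine ⟨(iso₀ f).hom ≫ s ≫ (iso₀ f).inv, ?_⟩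
  rw [twoTerm_d]
  simp only [Category.assoc, Iso.inv_hom_id_assoc]
  rw [← reassoc_of% hs]
  simp

/-- The chain endomorphism of `twoTerm f` with components `p` and `q`. -/
def chainEnd (p : X₀ ⟶ X₀) (q : X₁ ⟶ X₁) (h : p ≫ f = f ≫ q) : twoTerm f ⟶ twoTerm f :=
  HomologicalComplex.mkHomFromDouble double_rel neg_one_ne_zero_int
    (p ≫ (iso₀ f).inv) (q ≫ (iso₁ f).inv)
    (by rw [twoTerm_d]; simp [reassoc_of% h])
    (fun k _ => by
      rw [HomologicalComplex.double_d_eq_zero₀ _ _ _ _ neg_one_ne_zero_int.symm, comp_zero])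

theorem chainEnd_f₀ (p : X₀ ⟶ X₀) (q : X₁ ⟶ X₁) (h : p ≫ f = f ≫ q) :
    (chainEnd f p q h).f (-1) = (iso₀ f).hom ≫ p ≫ (iso₀ f).inv :=
  HomologicalComplex.mkHomFromDouble_f₀ ..

theorem chainEnd_f₁ (p : X₀ ⟶ X₀) (q : X₁ ⟶ X₁) (h : p ≫ f = f ≫ q) :
    (chainEnd f p q h).f 0 = (iso₁ f).hom ≫ q ≫ (iso₁ f).inv :=
  HomologicalComplex.mkHomFromDouble_f₁ ..

/-- Pairs of endomorphisms commuting with `f`, i.e. endomorphisms of `f` as an arrow. -/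
def ArrowEnd : Type v := {c : (X₀ ⟶ X₀) × (X₁ ⟶ X₁) // c.1 ≫ f = f ≫ c.2}

/-- The endomorphism in the derived category (as an element of the opposite ring) induced by an
endomorphism of the arrow `f`. -/
def toEndOp [HasDerivedCategory.{w} C] (c : ArrowEnd f) :
    (End (DerivedCategory.Q.obj (twoTerm f)))ᵐᵒᵖ :=
  MulOpposite.op (DerivedCategory.Q.map (chainEnd f c.1.1 c.1.2 c.2))

theorem toEndOp_surjective [HasDerivedCategory.{w} C] [Projective X₀] [Projective X₁] :
    Function.Surjective (toEndOp f) := by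
  intro g
  have := isKProjective_twoTerm f
  obtain ⟨c, hc⟩ := Q_map_surjective (twoTerm f) (twoTerm f) g.unop
  refine ⟨⟨((iso₀ f).inv ≫ c.f (-1) ≫ (iso₀ f).hom, (iso₁ f).inv ≫ c.f 0 ≫ (iso₁ f).hom), ?_⟩, ?_⟩
  · have := c.comm (-1) 0
    rw [twoTerm_d] at this
    have h2 := congrArg (fun t => (iso₀ f).inv ≫ t ≫ (iso₁ f).hom) this
    simpa using h2
  · apply MulOpposite.unop_injective
    rw [← hc]
    change DerivedCategory.Q.map _ = _
    congr 1
    apply HomologicalComplex.from_double_hom_ext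
    · rw [chainEnd_f₀]; simp
    · rw [chainEnd_f₁]; simp

theorem toEndOp_mul [HasDerivedCategory.{w} C] {a b c : ArrowEnd f} (h0 : a.1.1 ≫ b.1.1 = c.1.1)
    (h1 : a.1.2 ≫ b.1.2 = c.1.2) : toEndOp f a * toEndOp f b = toEndOp f c := by
  apply MulOpposite.unop_injective
  change DerivedCategory.Q.map _ ≫ DerivedCategory.Q.map _ = DerivedCategory.Q.map _
  rw [← Functor.map_comp]
  congr 1
  apply HomologicalComplex.from_double_hom_ext
  · simp [chainEnd_f₀, ← h0]
  · simp [chainEnd_f₁, ← h1]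

theorem toEndOp_eq_iff [HasDerivedCategory.{w} C]
    [Projective X₀] [Projective X₁] (a b : ArrowEnd f) :
    toEndOp f a = toEndOp f b ↔
      ∃ s : X₁ ⟶ X₀, a.1.1 - b.1.1 = f ≫ s ∧ a.1.2 - b.1.2 = s ≫ f := by
  have := isKProjective_twoTerm f
  rw [← MulOpposite.unop_injective.eq_iff]
  change DerivedCategory.Q.map _ = DerivedCategory.Q.map _ ↔ _
  rw [← sub_eq_zero, ← Functor.map_sub, Q_map_eq_zero_iff,
    (isTwoTerm_twoTerm f).homotopy_zero_iff _ (isTwoTerm_twoTerm f)]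
  simp only [HomologicalComplex.sub_f_apply, chainEnd_f₀, chainEnd_f₁, twoTerm_d]
  constructor
  · rintro ⟨s, h0, h1⟩
    refine ⟨(iso₁ f).inv ≫ s ≫ (iso₀ f).hom, ?_, ?_⟩
    · have := congrArg (fun t => (iso₀ f).inv ≫ t ≫ (iso₀ f).hom) h0
      simpa using this
    · have := congrArg (fun t => (iso₁ f).inv ≫ t ≫ (iso₁ f).hom) h1
      simpa using this
  · rintro ⟨s, h0, h1⟩
    refine ⟨(iso₁ f).hom ≫ s ≫ (iso₀ f).inv, ?_, ?_⟩
    · have := congrArg (fun t => (iso₀ f).hom ≫ t ≫ (iso₀ f).inv) h0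
      simpa using this
    · have := congrArg (fun t => (iso₁ f).hom ≫ t ≫ (iso₁ f).inv) h1
      simpa using this

end TwoTerm

theorem isZero_of_terms {C : Type u} [Category.{v} C] [Abelian C]
    (X : CochainComplex C ℤ) (h : ∀ i, IsZero (X.X i)) : IsZero X := by
  rw [IsZero.iff_id_eq_zero]
  ext i
  exact (h i).eq_of_src _ _

section Thick

variable {C : Type u} [Category.{v} C] [Abelian C] [HasDerivedCategory.{w} C]
  {S : Set (DerivedCategory C)}

namespace IsThick

theorem of_iso (hS : IsThick S) {X Y : DerivedCategory C} (e : X ≅ Y) (h : X ∈ S) : Y ∈ S :=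
  hS.1 e h

theorem of_retract (hS : IsThick S) {X Y : DerivedCategory C} (r : Retract X Y) (h : Y ∈ S) :
    X ∈ S :=
  hS.2.2.2 X Y r.i r.r r.retract h

theorem single (hS : IsThick S) (M : C) (a b : ℤ)
    (h : (DerivedCategory.singleFunctor C a).obj M ∈ S) :
    (DerivedCategory.singleFunctor C b).obj M ∈ S :=
  hS.of_iso (((DerivedCategory.singleFunctors C).shiftIso (a - b) b a (by omega)).app M)
    (hS.2.1 _ (a - b) h)

theorem single_of_retract (hS : IsThick S) {M N : C} (r : Retract M N)
    (h : (DerivedCategory.singleFunctor C 0).obj N ∈ S) :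
    (DerivedCategory.singleFunctor C 0).obj M ∈ S :=
  hS.of_retract (r.map _) h

theorem single_of_shortExact (hS : IsThick S) {T : ShortComplex C} (hT : T.ShortExact)
    (h₁ : (DerivedCategory.singleFunctor C 0).obj T.X₁ ∈ S)
    (h₃ : (DerivedCategory.singleFunctor C 0).obj T.X₃ ∈ S) :
    (DerivedCategory.singleFunctor C 0).obj T.X₂ ∈ S :=
  hS.2.2.1 hT.singleTriangle hT.singleTriangle_distinguished h₁ h₃

theorem single_biprod (hS : IsThick S) {M N : C}
    (h₁ : (DerivedCategory.singleFunctor C 0).obj M ∈ S)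
    (h₃ : (DerivedCategory.singleFunctor C 0).obj N ∈ S) :
    (DerivedCategory.singleFunctor C 0).obj (M ⊞ N) ∈ S :=
  hS.single_of_shortExact (ShortComplex.Splitting.ofHasBinaryBiproduct M N).shortExact h₁ h₃

theorem of_isZero (hS : IsThick S) {Y : DerivedCategory C} (hY : Y ∈ S)
    {X : DerivedCategory C} (hX : IsZero X) : X ∈ S :=
  hS.2.2.2 X Y 0 0 (hX.eq_of_src _ _) hY

end IsThick

/-- Splitting off the top term of a complex. -/
theorem exists_triangle_top (X : CochainComplex C ℤ) (b : ℤ) (hX : ∀ i, b < i → IsZero (X.X i)) :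
    ∃ (X' : CochainComplex C ℤ) (T : Triangle (DerivedCategory C)), T ∈ distTriang _ ∧
      T.obj₁ = (DerivedCategory.singleFunctor C b).obj (X.X b) ∧
      T.obj₂ = DerivedCategory.Q.obj X ∧ T.obj₃ = DerivedCategory.Q.obj X' ∧
      IsZero (X'.X b) ∧ ∀ i, i ≠ b → Nonempty (X.X i ≅ X'.X i) := by
  let ι : (HomologicalComplex.single C (ComplexShape.up ℤ) b).obj (X.X b) ⟶ X :=
    HomologicalComplex.mkHomFromSingle (𝟙 _) (fun k hk => by
      have hk' : b + 1 = k := hk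
      exact (hX k (by omega)).eq_of_tgt _ _)
  have hb : IsIso (ι.f b) := by
    rw [show ι.f b = _ from HomologicalComplex.mkHomFromSingle_f _ _, Category.comp_id]
    infer_instance
  have hz : ∀ i, i ≠ b → IsZero (((HomologicalComplex.single C (ComplexShape.up ℤ) b).obj
      (X.X b)).X i) := fun i hi => HomologicalComplex.isZero_single_obj_X _ _ _ _ hi
  have : Mono ι := by
    apply HomologicalComplex.mono_of_mono_f
    intro i
    by_cases hi : i = b
    · subst hi; infer_instance
    · exact ⟨fun _ _ _ => (hz i hi).eq_of_tgt _ _⟩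
  let T : ShortComplex (CochainComplex C ℤ) := ShortComplex.mk ι (cokernel.π ι) (by simp)
  have hT : T.ShortExact := { exact := ShortComplex.exact_of_g_is_cokernel _ (cokernelIsCokernel ι) }
  have hTi := (HomologicalComplex.shortExact_iff_degreewise_shortExact T).1 hT
  refine ⟨cokernel ι, DerivedCategory.triangleOfSES hT,
    DerivedCategory.triangleOfSES_distinguished hT, rfl, rfl, rfl, ?_, ?_⟩
  · have : Epi (T.map (HomologicalComplex.eval C (ComplexShape.up ℤ) b)).f :=
      inferInstanceAs (Epi (ι.f b))
    have h0 := (hTi b).exact.epi_f_iff.1 this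
    have := (hTi b).epi_g
    have hz' := IsZero.of_epi_eq_zero _ h0
    exact hz'
  · intro i hi
    have h0 : (T.map (HomologicalComplex.eval C (ComplexShape.up ℤ) i)).f = 0 :=
      (hz i hi).eq_of_src _ _
    have := (hTi i).epi_g
    have : Mono (T.map (HomologicalComplex.eval C (ComplexShape.up ℤ) i)).g :=
      (hTi i).exact.mono_g_iff.2 h0
    have := isIso_of_mono_of_epi (T.map (HomologicalComplex.eval C (ComplexShape.up ℤ) i)).g
    let e := asIso (T.map (HomologicalComplex.eval C (ComplexShape.up ℤ) i)).g
    exact ⟨e⟩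

theorem IsThick.Q_mem (hS : IsThick S) (a : ℤ) (n : ℕ) :
    ∀ X : CochainComplex C ℤ, (∀ i, i < a ∨ a + n ≤ i → IsZero (X.X i)) →
      (∀ i, (DerivedCategory.singleFunctor C 0).obj (X.X i) ∈ S) →
        DerivedCategory.Q.obj X ∈ S := by
  induction n with
  | zero =>
    intro X hX hXS
    have : IsZero X := isZero_of_terms X fun i => hX i (by omega)
    exact hS.of_isZero (hXS 0) (DerivedCategory.Q.map_isZero this)
  | succ n ih =>
    intro X hX hXS
    obtain ⟨X', T, hT, h₁, h₂, h₃, hb, hi⟩ :=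
      exists_triangle_top X (a + n) fun i hi => hX i (by omega)
    rw [← h₂]
    refine hS.2.2.1 T hT (h₁ ▸ hS.single _ 0 _ (hXS _)) (h₃ ▸ ih X' (fun i h => ?_) fun i => ?_)
    · by_cases hib : i = a + n
      · exact hib ▸ hb
      · obtain ⟨e⟩ := hi i hib
        exact (hX i (by omega)).of_iso e.symm
    · by_cases hib : i = a + n
      · exact hS.of_isZero (hXS 0)
          ((DerivedCategory.singleFunctor C 0).map_isZero (hib ▸ hb))
      · obtain ⟨e⟩ := hi i hib
        exact hS.of_iso ((DerivedCategory.singleFunctor C 0).mapIso e) (hXS i)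

theorem IsThick.single_target_mem (hS : IsThick S) {X₀ X₁ : C} (f : X₀ ⟶ X₁)
    (h : DerivedCategory.Q.obj (twoTerm f) ∈ S)
    (h₀ : (DerivedCategory.singleFunctor C 0).obj X₀ ∈ S) :
    (DerivedCategory.singleFunctor C 0).obj X₁ ∈ S := by
  obtain ⟨X', T, hT, h₁, h₂, h₃, hb, hi⟩ := exists_triangle_top (twoTerm f) 0
    fun i hi => isTwoTerm_twoTerm f i (by omega) (by omega)
  have hX' : ∀ i, i ≠ -1 → IsZero (X'.X i) := by
    intro i hi1
    by_cases h0 : i = 0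
    · exact h0 ▸ hb
    · obtain ⟨e⟩ := hi i h0
      exact (isTwoTerm_twoTerm f i hi1 h0).of_iso e.symm
  have hQX' : DerivedCategory.Q.obj X' ∈ S := by
    refine hS.Q_mem (-1) 1 X' (fun i h => hX' i (by omega)) fun i => ?_
    by_cases hi1 : i = -1
    · subst hi1
      obtain ⟨e⟩ := hi (-1) (by simp)
      exact hS.of_iso ((DerivedCategory.singleFunctor C 0).mapIso ((iso₀ f).symm ≪≫ e)) h₀
    · exact hS.of_isZero h ((DerivedCategory.singleFunctor C 0).map_isZero (hX' i hi1))
  have : T.obj₁ ∈ S := hS.2.2.1 T.invRotate (inv_rot_of_distTriang _ hT)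
    (hS.2.1 _ (-1) (h₃ ▸ hQX')) (show T.obj₂ ∈ S from h₂ ▸ h)
  rw [h₁] at this
  exact hS.of_iso ((DerivedCategory.singleFunctor C 0).mapIso (iso₁ f)) this

theorem IsThick.single_summand_mem (hS : IsThick S) {X₀ X₁ M : C} (f : X₀ ⟶ X₁)
    (h : DerivedCategory.Q.obj (twoTerm f) ∈ S) (i : M ⟶ X₀) (r : X₀ ⟶ M) (hir : i ≫ r = 𝟙 M)
    (hif : i ≫ f = 0) : (DerivedCategory.singleFunctor C 0).obj M ∈ S := by
  let φ : (HomologicalComplex.single C (ComplexShape.up ℤ) (-1)).obj M ⟶ twoTerm f :=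
    HomologicalComplex.mkHomFromSingle (i ≫ (iso₀ f).inv) (fun k hk => by
      obtain rfl : 0 = k := by have : (-1 : ℤ) + 1 = k := hk; omega
      simp [twoTerm_d, reassoc_of% hif])
  let ψ : twoTerm f ⟶ (HomologicalComplex.single C (ComplexShape.up ℤ) (-1)).obj M :=
    HomologicalComplex.mkHomToSingle ((iso₀ f).hom ≫ r) (fun k hk => by
      have hk' : k + 1 = -1 := hk
      exact (isTwoTerm_twoTerm f k (by omega) (by omega)).eq_of_src _ _)
  have hφψ : φ ≫ ψ = 𝟙 _ := by
    apply HomologicalComplex.from_single_hom_ext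
    simp [φ, ψ, reassoc_of% hir]
  exact hS.single M (-1) 0 (hS.of_retract (r := (Retract.mk φ ψ hφψ).map DerivedCategory.Q) h)

theorem IsThick.single_of_projective {R : Type} [Ring R]
    [HasDerivedCategory.{w} (ModuleCat.{0} R)] {S : Set (DerivedCategory (ModuleCat.{0} R))}
    (hS : IsThick S)
    (hR : (DerivedCategory.singleFunctor (ModuleCat.{0} R) 0).obj (ModuleCat.of R R) ∈ S)
    (M : ModuleCat.{0} R) [Projective M] (hM : Module.Finite R M) :
    (DerivedCategory.singleFunctor (ModuleCat.{0} R) 0).obj M ∈ S := by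
  have key : ∀ n : ℕ, (DerivedCategory.singleFunctor (ModuleCat.{0} R) 0).obj
      (ModuleCat.of R (Fin n → R)) ∈ S := by
    intro n
    induction n with
    | zero =>
      exact hS.of_isZero hR ((DerivedCategory.singleFunctor _ 0).map_isZero
        (ModuleCat.isZero_of_subsingleton _))
    | succ n ih =>
      exact hS.of_iso ((DerivedCategory.singleFunctor _ 0).mapIso
        (ModuleCat.biprodIsoProd (ModuleCat.of R R) (ModuleCat.of R (Fin n → R)) ≪≫
          (Fin.consLinearEquiv R (fun _ : Fin (n + 1) => R)).toModuleIso))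
        (hS.single_biprod hR ih)
  obtain ⟨n, p, hp⟩ := Module.Finite.exists_fin' R M
  have : Epi (ModuleCat.ofHom p) := (ModuleCat.epi_iff_surjective _).2 hp
  exact hS.single_of_retract
    (Retract.mk (Projective.factorThru (𝟙 M) (ModuleCat.ofHom p)) (ModuleCat.ofHom p)
      (Projective.factorThru_comp _ _)) (key n)

/-- A two-term complex `X₀ ⟶ X₁` of finitely generated projectives is silting as soon as every
morphism `X₀ ⟶ X₁` factors through it and the regular module is built from a summand of `X₀`
lying in its kernel and from `X₁`. -/
theorem isTwoTermSilting_twoTerm {R : Type} [Ring R]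
    [HasDerivedCategory.{w} (ModuleCat.{0} R)] {X₀ X₁ M : ModuleCat.{0} R}
    [Projective X₀] [Projective X₁] (hX₀ : Module.Finite R X₀) (hX₁ : Module.Finite R X₁)
    (f : X₀ ⟶ X₁) (hf : ∀ u : X₀ ⟶ X₁, ∃ s, u = s ≫ f) (i : M ⟶ X₀) (r : X₀ ⟶ M)
    (hir : i ≫ r = 𝟙 M) (hif : i ≫ f = 0) (eX : X₀ ≅ M ⊞ M)
    (eR : M ⊞ X₁ ≅ ModuleCat.of R R) : IsTwoTermSilting R (twoTerm f) := by
  refine ⟨⟨projective_twoTerm_X f, fun j => ?_, isTwoTerm_twoTerm f⟩,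
    hom_twoTerm_shift_eq_zero f hf, fun S hS hP X hX => ?_⟩
  · by_cases h1 : j = -1
    · subst h1
      exact Module.Finite.equiv (iso₀ f).symm.toLinearEquiv
    by_cases h0 : j = 0
    · subst h0
      exact Module.Finite.equiv (iso₁ f).symm.toLinearEquiv
    · have := ModuleCat.subsingleton_of_isZero (isTwoTerm_twoTerm f j h1 h0)
      infer_instance
  · have hM := hS.single_summand_mem f hP i r hir hif
    have h₀ := hS.of_iso ((DerivedCategory.singleFunctor _ 0).mapIso eX.symm)
      (hS.single_biprod hM hM)
    have h₁ := hS.single_target_mem f hP h₀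
    have hR := hS.of_iso ((DerivedCategory.singleFunctor _ 0).mapIso eR) (hS.single_biprod hM h₁)
    obtain ⟨hXp, hXf, a, b, hab⟩ := hX
    refine hS.Q_mem a (b + 1 - a).toNat X (fun j hj => hab j (by omega)) fun j => ?_
    have := hXp j
    exact hS.single_of_projective hR _ (hXf j)

end Thick

section RightIdeals

open MulOpposite

variable {A : Type} [Ring A]

/-- The right ideal `e A` of an idempotent `e`. -/
def rightIdeal (e : A) : Submodule Aᵐᵒᵖ A where
  carrier := {x | e * x = x}
  add_mem' {x y} hx hy := by
    change e * x = x at hx; change e * y = y at hy; change e * (x + y) = x + y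
    rw [mul_add, hx, hy]
  zero_mem' := mul_zero e
  smul_mem' r x hx := by
    change e * x = x at hx; change e * (x * r.unop) = x * r.unop
    rw [← mul_assoc, hx]

theorem mem_rightIdeal {e x : A} : x ∈ rightIdeal e ↔ e * x = x := Iff.rfl

/-- Left multiplication by `a ∈ e' A` as a map `e A → e' A`. -/
def leftMul (e : A) {e' : A} (a : A) (h : e' * a = a) :
    rightIdeal e →ₗ[Aᵐᵒᵖ] rightIdeal e' where
  toFun x := ⟨a * x.1, by rw [mem_rightIdeal, ← mul_assoc, h]⟩
  map_add' x y := Subtype.ext (mul_add a x.1 y.1)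
  map_smul' r x := Subtype.ext (mul_assoc a x.1 r.unop).symm

@[simp]
theorem leftMul_coe (e : A) {e' : A} (a : A) (h : e' * a = a) (x : rightIdeal e) :
    (leftMul e a h x : A) = a * x.1 := rfl

/-- Left multiplication by an idempotent, as a projection of `A` onto `e A`. -/
def toRightIdeal (e : A) (he : e * e = e) : A →ₗ[Aᵐᵒᵖ] rightIdeal e where
  toFun x := ⟨e * x, by rw [mem_rightIdeal, ← mul_assoc, he]⟩
  map_add' x y := Subtype.ext (mul_add e x y)
  map_smul' r x := Subtype.ext (mul_assoc e x r.unop).symm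

theorem linearMap_rightIdeal_apply {e e' : A} (he : e * e = e)
    (φ : rightIdeal e →ₗ[Aᵐᵒᵖ] rightIdeal e') (x : rightIdeal e) :
    (φ x : A) = (φ ⟨e, he⟩ : A) * x.1 := by
  have : x = op x.1 • (⟨e, he⟩ : rightIdeal e) := Subtype.ext (mem_rightIdeal.1 x.2).symm
  conv_lhs => rw [this, map_smul]
  rfl

/-- `A` is free of rank one as a right module over itself. -/
def regularEquiv (A : Type) [Ring A] : A ≃ₗ[Aᵐᵒᵖ] Aᵐᵒᵖ where
  toFun := op
  invFun := unop
  left_inv _ := rfl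
  right_inv _ := rfl
  map_add' _ _ := rfl
  map_smul' _ _ := rfl

instance : Module.Finite Aᵐᵒᵖ A := Module.Finite.equiv (regularEquiv A).symm

instance : Module.Projective Aᵐᵒᵖ A := Module.Projective.of_equiv (regularEquiv A).symm

theorem projective_rightIdeal {e : A} (he : e * e = e) : Module.Projective Aᵐᵒᵖ (rightIdeal e) :=
  Module.Projective.of_split (rightIdeal e).subtype (toRightIdeal e he)
    (by ext x; exact mem_rightIdeal.1 x.2)

theorem finite_rightIdeal {e : A} (he : e * e = e) : Module.Finite Aᵐᵒᵖ (rightIdeal e) :=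
  Module.Finite.of_surjective (toRightIdeal e he)
    fun x => ⟨x.1, Subtype.ext (mem_rightIdeal.1 x.2)⟩

/-- The Peirce decomposition `e A ⊕ (1 - e) A = A`. -/
def peirceEquiv {e e' : A} (he : e * e = e) (he' : e' * e' = e') (h : e + e' = 1) :
    (rightIdeal e × rightIdeal e') ≃ₗ[Aᵐᵒᵖ] A :=
  have hee' : e * e' = 0 := by
    have := congrArg (e * ·) h
    simpa [mul_add, he] using this
  have he'e : e' * e = 0 := by
    have := congrArg (· * e) h
    simpa [add_mul, he] using this
  LinearEquiv.ofLinearMap ((rightIdeal e).subtype.coprod (rightIdeal e').subtype)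
    ((toRightIdeal e he).prod (toRightIdeal e' he'))
    (LinearMap.ext fun x => by
      change e * x + e' * x = x
      rw [← add_mul, h, one_mul])
    (by
      ext x <;> obtain ⟨x, hx⟩ := x <;> rw [mem_rightIdeal] at hx
      · change e * (x + 0) = x
        rw [add_zero, hx]
      · change e' * (x + 0) = 0
        rw [add_zero, ← hx, ← mul_assoc, he'e, zero_mul]
      · change e * (0 + x) = 0
        rw [zero_add, ← hx, ← mul_assoc, hee', zero_mul]
      · change e' * (0 + x) = x
        rw [zero_add, hx])

end RightIdeals

section Simples

open MulOpposite

variable {k A : Type} [Field k] [Ring A] [Algebra k A]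

/-- The one-dimensional right module given by a character. -/
def CharModule (_χ : A →ₐ[k] k) : Type := k

instance (χ : A →ₐ[k] k) : AddCommGroup (CharModule χ) := inferInstanceAs (AddCommGroup k)

instance (χ : A →ₐ[k] k) : Module Aᵐᵒᵖ (CharModule χ) where
  smul := fun r (y : k) => (χ r.unop * y : k)
  one_smul := fun (y : k) => by change χ 1 * y = y; rw [map_one, one_mul]
  mul_smul := fun r s (y : k) => by
    change χ (s.unop * r.unop) * y = χ r.unop * (χ s.unop * y)
    rw [map_mul]; ring
  smul_zero r := mul_zero (χ r.unop)
  smul_add := fun r (x y : k) => mul_add (χ r.unop) x y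
  add_smul := fun r s (y : k) => by
    change χ (r.unop + s.unop) * y = χ r.unop * y + χ s.unop * y
    rw [map_add, add_mul]
  zero_smul := fun (y : k) => by change χ 0 * y = (0 : k); rw [map_zero, zero_mul]

/-- The restriction of a character to a right ideal. -/
def charMap (χ : A →ₐ[k] k) (e : A) : rightIdeal e →ₗ[Aᵐᵒᵖ] CharModule χ where
  toFun x := χ x.1
  map_add' x y := map_add χ x.1 y.1
  map_smul' r x := (map_mul χ x.1 r.unop).trans (mul_comm _ _)

/-- The map from a one-dimensional module given by an eigenvector. -/
def eigenMap (χ : A →ₐ[k] k) {N : Type} [AddCommGroup N] [Module Aᵐᵒᵖ N] (z : N)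
    (hz : ∀ r : A, op r • z = op (algebraMap k A (χ r)) • z) :
    CharModule χ →ₗ[Aᵐᵒᵖ] N where
  toFun := fun (c : k) => op (algebraMap k A c) • z
  map_add' := fun (c d : k) => by
    change op (algebraMap k A (c + d)) • z = _
    rw [map_add, MulOpposite.op_add, add_smul]
  map_smul' := fun r (c : k) => by
    change op (algebraMap k A (χ r.unop * c)) • z = r • op (algebraMap k A c) • z
    rw [map_mul, MulOpposite.op_mul, mul_smul, ← hz, ← mul_smul, ← mul_smul, op_unop]
    congr 1
    apply unop_injective
    exact (Algebra.commutes _ _).symm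

theorem eigenMap_injective (χ : A →ₐ[k] k) {N : Type} [AddCommGroup N] [Module Aᵐᵒᵖ N] (z : N)
    (hz : ∀ r : A, op r • z = op (algebraMap k A (χ r)) • z) (hz0 : z ≠ 0) :
    Function.Injective (eigenMap χ z hz) := by
  rw [injective_iff_map_eq_zero]
  intro (c : k) (hc : op (algebraMap k A c) • z = 0)
  by_contra (hne : c ≠ 0)
  apply hz0
  have h := congrArg (op (algebraMap k A c⁻¹) • ·) hc
  rwa [smul_zero, ← mul_smul, ← MulOpposite.op_mul, ← map_mul, mul_inv_cancel₀ hne, map_one,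
    MulOpposite.op_one, one_smul] at h

/-- If `A` modulo a nilpotent ideal is a product of copies of `k`, then the simple modules are
the corresponding one-dimensional ones. -/
theorem exists_charModule_equiv {ι : Type} [Fintype ι] [DecidableEq ι] (χ : ι → (A →ₐ[k] k))
    (ε : ι → A) (hχε : ∀ i j, χ i (ε j) = if i = j then 1 else 0)
    (hJ : ∀ x : A, (∀ i, χ i x = 0) → x * x * x = 0) (N : Type) [AddCommGroup N]
    [Module Aᵐᵒᵖ N] [IsSimpleModule Aᵐᵒᵖ N] :
    ∃ i, Nonempty (CharModule (χ i) ≃ₗ[Aᵐᵒᵖ] N) := by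
  have hkill : ∀ r : A, (∀ i, χ i r = 0) → ∀ y : N, op r • y = 0 := by
    intro r hr y
    by_contra hne
    obtain ⟨s, hs⟩ := IsSimpleModule.toSpanSingleton_surjective Aᵐᵒᵖ hne y
    rw [LinearMap.toSpanSingleton_apply, ← mul_smul] at hs
    have ht : ∀ i, χ i (r * s.unop) = 0 := fun i => by rw [map_mul, hr, zero_mul]
    have h3 := hJ _ ht
    have hs' : op (r * s.unop) • y = y := hs
    generalize r * s.unop = t at h3 hs'
    have hy : op (t * t * t) • y = y := by
      rw [MulOpposite.op_mul, mul_smul, MulOpposite.op_mul, mul_smul, hs', hs', hs']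
    rw [h3, MulOpposite.op_zero, zero_smul] at hy
    exact hne (by rw [← hy, smul_zero])
  have := IsSimpleModule.nontrivial Aᵐᵒᵖ N
  obtain ⟨y, hy⟩ := exists_ne (0 : N)
  obtain ⟨i, hi⟩ : ∃ i, op (ε i) • y ≠ 0 := by
    by_contra! hall
    apply hy
    have h1 := hkill (1 - ∑ i, ε i) (fun i => by simp [hχε]) y
    rw [MulOpposite.op_sub, MulOpposite.op_one, Finset.op_sum, sub_smul, one_smul, Finset.sum_smul,
      Finset.sum_eq_zero fun i _ => hall i, sub_zero] at h1
    exact h1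
  have hz : ∀ r : A, op r • (op (ε i) • y) = op (algebraMap k A (χ i r)) • (op (ε i) • y) := by
    intro r
    rw [← sub_eq_zero, ← mul_smul, ← mul_smul, ← sub_smul]
    refine hkill (ε i * r - ε i * algebraMap k A (χ i r)) (fun j => ?_) y
    rw [map_sub, map_mul, map_mul, hχε, AlgHom.commutes]
    by_cases hji : j = i
    · subst hji; simp
    · simp [hji]
  refine ⟨i, ⟨LinearEquiv.ofBijective (eigenMap (χ i) _ hz)
    ⟨eigenMap_injective _ _ hz hi, ?_⟩⟩⟩
  rw [← LinearMap.range_eq_top]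
  refine (IsSimpleOrder.eq_bot_or_eq_top _).resolve_left fun hbot => hi ?_
  have : eigenMap (χ i) _ hz (1 : k) ∈ LinearMap.range (eigenMap (χ i) _ hz) := ⟨_, rfl⟩
  rw [hbot, Submodule.mem_bot] at this
  have h1 : op (algebraMap k A 1) • (op (ε i) • y) = 0 := this
  rwa [map_one, MulOpposite.op_one, one_smul] at h1

end Simples

section FiniteLength

theorem hasProjectiveDimensionLT_of_isFiniteLength {R : Type} [Ring R] (d : ℕ)
    (h : ∀ (N : Type) [AddCommGroup N] [Module R N] [IsSimpleModule R N],
      HasProjectiveDimensionLT (ModuleCat.of R N) d)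
    {M : Type} [AddCommGroup M] [Module R M] (hM : IsFiniteLength R M) :
    HasProjectiveDimensionLT (ModuleCat.of R M) d := by
  induction hM with
  | @of_subsingleton M _ _ _ =>
    have := (ModuleCat.isZero_of_subsingleton (ModuleCat.of R M)).hasProjectiveDimensionLT_zero
    exact hasProjectiveDimensionLT_of_ge _ 0 d (Nat.zero_le d)
  | @of_simple_quotient M _ _ N _ _ ih =>
    let S : ShortComplex (ModuleCat.{0} R) :=
      ShortComplex.mk (ModuleCat.ofHom N.subtype) (ModuleCat.ofHom N.mkQ)
        (by ext x; exact (Submodule.Quotient.mk_eq_zero N).2 x.2)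
    have hS : S.ShortExact := ModuleCat.shortComplex_shortExact S
      (fun x => by
        change N.mkQ x = 0 ↔ x ∈ Set.range N.subtype
        simp)
      N.injective_subtype N.mkQ_surjective
    exact hS.hasProjectiveDimensionLT_X₂ d ih (h (M ⧸ N))

theorem gldLE_of_simples {R : Type} [Ring R] [IsArtinianRing R] (d : ℕ)
    (h : ∀ (N : Type) [AddCommGroup N] [Module R N] [IsSimpleModule R N],
      HasProjectiveDimensionLT (ModuleCat.of R N) (d + 1)) : gldLE.{0, 0} R d := by
  intro M hM
  rw [pdLE_iff_hasProjectiveDimensionLT]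
  exact hasProjectiveDimensionLT_of_isFiniteLength (d + 1) h
    (isFiniteLength_iff_isNoetherian_isArtinian.2 ⟨inferInstance, inferInstance⟩)

end FiniteLength

/-- The path algebra with relations of the quiver with vertices `0, …, m + 2` and `s`, and arrows
`a i` from `i + 1` to `i`, `b` from `0` to `2` and `g` from `2` to `s`, in which the only nonzero
products of two arrows are `p = b * a 1` and `q = b * g`. -/
@[ext]
structure PathAlg (k : Type) (m : ℕ) where
  /-- The coefficients of the idempotents at `0, …, m + 2`. -/
  e : Fin (m + 3) → k
  /-- The coefficients of the arrows of the chain. -/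
  a : Fin (m + 2) → k
  /-- The coefficient of the idempotent at `s`. -/
  es : k
  /-- The coefficient of the arrow from `0` to `2`. -/
  b : k
  /-- The coefficient of the arrow from `2` to `s`. -/
  g : k
  /-- The coefficient of the path from `0` to `1`. -/
  p : k
  /-- The coefficient of the path from `0` to `s`. -/
  q : k

namespace PathAlg

variable {k : Type} {m : ℕ}

/-- The coordinates of an element. -/
def coords : PathAlg k m ≃
    (Fin (m + 3) → k) × (Fin (m + 2) → k) × k × k × k × k × k where
  toFun x := (x.e, x.a, x.es, x.b, x.g, x.p, x.q)
  invFun y := ⟨y.1, y.2.1, y.2.2.1, y.2.2.2.1, y.2.2.2.2.1, y.2.2.2.2.2.1, y.2.2.2.2.2.2⟩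
  left_inv _ := rfl
  right_inv _ := rfl

variable [Field k]

instance : AddCommGroup (PathAlg k m) := coords.addCommGroup

instance : Module k (PathAlg k m) := coords.module k

instance : Module.Finite k (PathAlg k m) := Module.Finite.equiv (coords.linearEquiv k).symm

@[simps]
instance : Mul (PathAlg k m) where
  mul x y :=
    { e j := x.e j * y.e j
      a i := x.e i.succ * y.a i + x.a i * y.e i.castSucc
      es := x.es * y.es
      b := x.e 0 * y.b + x.b * y.e 2
      g := x.e 2 * y.g + x.g * y.es
      p := x.e 0 * y.p + x.b * y.a 1 + x.p * y.e 1
      q := x.e 0 * y.q + x.b * y.g + x.q * y.es }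

@[simps]
instance : One (PathAlg k m) := ⟨⟨1, 0, 1, 0, 0, 0, 0⟩⟩

section Coordinates

variable (x y : PathAlg k m) (c : k) (j : Fin (m + 3)) (i : Fin (m + 2))

@[simp] theorem add_e : (x + y).e j = x.e j + y.e j := rfl
@[simp] theorem add_a : (x + y).a i = x.a i + y.a i := rfl
@[simp] theorem add_es : (x + y).es = x.es + y.es := rfl
@[simp] theorem add_b : (x + y).b = x.b + y.b := rfl
@[simp] theorem add_g : (x + y).g = x.g + y.g := rfl
@[simp] theorem add_p : (x + y).p = x.p + y.p := rfl
@[simp] theorem add_q : (x + y).q = x.q + y.q := rfl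
@[simp] theorem sub_e : (x - y).e j = x.e j - y.e j := rfl
@[simp] theorem sub_a : (x - y).a i = x.a i - y.a i := rfl
@[simp] theorem sub_es : (x - y).es = x.es - y.es := rfl
@[simp] theorem sub_b : (x - y).b = x.b - y.b := rfl
@[simp] theorem sub_g : (x - y).g = x.g - y.g := rfl
@[simp] theorem sub_p : (x - y).p = x.p - y.p := rfl
@[simp] theorem sub_q : (x - y).q = x.q - y.q := rfl
@[simp] theorem zero_e : (0 : PathAlg k m).e j = 0 := rfl
@[simp] theorem zero_a : (0 : PathAlg k m).a i = 0 := rfl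
@[simp] theorem zero_es : (0 : PathAlg k m).es = 0 := rfl
@[simp] theorem zero_b : (0 : PathAlg k m).b = 0 := rfl
@[simp] theorem zero_g : (0 : PathAlg k m).g = 0 := rfl
@[simp] theorem zero_p : (0 : PathAlg k m).p = 0 := rfl
@[simp] theorem zero_q : (0 : PathAlg k m).q = 0 := rfl
@[simp] theorem smul_e : (c • x).e j = c * x.e j := rfl
@[simp] theorem smul_a : (c • x).a i = c * x.a i := rfl
@[simp] theorem smul_es : (c • x).es = c * x.es := rfl
@[simp] theorem smul_b : (c • x).b = c * x.b := rfl
@[simp] theorem smul_g : (c • x).g = c * x.g := rfl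
@[simp] theorem smul_p : (c • x).p = c * x.p := rfl
@[simp] theorem smul_q : (c • x).q = c * x.q := rfl

end Coordinates

instance : Ring (PathAlg k m) :=
  { (inferInstance : AddCommGroup (PathAlg k m)) with
    left_distrib := fun x y z => by ext <;> simp <;> ring
    right_distrib := fun x y z => by ext <;> simp <;> ring
    zero_mul := fun x => by ext <;> simp
    mul_zero := fun x => by ext <;> simp
    mul_assoc := fun x y z => by ext <;> simp <;> ring
    one_mul := fun x => by ext <;> simp
    mul_one := fun x => by ext <;> simp }

instance : Algebra k (PathAlg k m) := Algebra.ofModule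
  (fun c x y => by ext <;> simp <;> ring) (fun c x y => by ext <;> simp <;> ring)

/-- The idempotent at `j`. -/
@[simps]
def E (j : Fin (m + 3)) : PathAlg k m := ⟨Pi.single j 1, 0, 0, 0, 0, 0, 0⟩

/-- The idempotent at `s`. -/
@[simps]
def Es : PathAlg k m := ⟨0, 0, 1, 0, 0, 0, 0⟩

/-- The arrow from `i + 1` to `i`. -/
@[simps]
def al (i : Fin (m + 2)) : PathAlg k m := ⟨0, Pi.single i 1, 0, 0, 0, 0, 0⟩

/-- The arrow from `0` to `2`. -/
@[simps]
def be : PathAlg k m := ⟨0, 0, 0, 1, 0, 0, 0⟩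

/-- The arrow from `2` to `s`. -/
@[simps]
def ga : PathAlg k m := ⟨0, 0, 0, 0, 1, 0, 0⟩

theorem zero_ne_two : (0 : Fin (m + 3)) ≠ 2 := by simp [Fin.ext_iff, Nat.mod_eq_of_lt]

theorem succ_eq_two (i : Fin (m + 2)) : i.succ = 2 ↔ i = 1 := by
  rw [← Fin.succ_one_eq_two, Fin.succ_inj]

theorem E_mul_E (j : Fin (m + 3)) : (E j * E j : PathAlg k m) = E j := by
  ext <;> simp [Pi.single_apply]

theorem Es_mul_Es : (Es * Es : PathAlg k m) = Es := by
  ext <;> simp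

/-- The character at a vertex; `none` is the vertex `s`. -/
def chi : Option (Fin (m + 3)) → (PathAlg k m →ₐ[k] k)
  | none => AlgHom.ofLinearMap
      { toFun x := x.es, map_add' _ _ := rfl, map_smul' _ _ := rfl } rfl fun _ _ => rfl
  | some j => AlgHom.ofLinearMap
      { toFun x := x.e j, map_add' _ _ := rfl, map_smul' _ _ := rfl } rfl fun _ _ => rfl

@[simp] theorem chi_none (x : PathAlg k m) : chi none x = x.es := rfl
@[simp] theorem chi_some (j : Fin (m + 3)) (x : PathAlg k m) : chi (some j) x = x.e j := rfl

/-- The idempotent at a vertex; `none` is the vertex `s`. -/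
def idem : Option (Fin (m + 3)) → PathAlg k m
  | none => Es
  | some j => E j

theorem chi_idem (i j : Option (Fin (m + 3))) :
    chi i (idem j : PathAlg k m) = if i = j then 1 else 0 := by
  rcases i with _ | i <;> rcases j with _ | j <;> simp [idem, Pi.single_apply]

theorem cube_eq_zero (x : PathAlg k m) (hx : ∀ i, chi i x = 0) : x * x * x = 0 := by
  have hs : x.es = 0 := hx none
  have he : ∀ j, x.e j = 0 := fun j => hx (some j)
  ext <;> simp [hs, he]

theorem algebraMap_mul' (c : k) (x : PathAlg k m) : x * algebraMap k _ c = c • x := by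
  rw [Algebra.algebraMap_eq_smul_one, mul_smul_comm, mul_one]

theorem E_mul_al (i : Fin (m + 2)) : (E i.succ * al i : PathAlg k m) = al i := by
  ext j <;> simp [Pi.single_apply]

theorem E_mul_ga : (E 2 * ga : PathAlg k m) = ga := by
  ext j <;> simp

theorem E_mul_be : (E 0 * be : PathAlg k m) = be := by
  ext j <;> simp

end PathAlg

section

open MulOpposite

theorem charMap_surjective {k A : Type} [Field k] [Ring A] [Algebra k A]
    (χ : A →ₐ[k] k) {e : A} (he : e * e = e) (hχ : χ e = 1) :
    Function.Surjective (charMap χ e) :=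
  fun (c : k) => ⟨op (algebraMap k A c) • (⟨e, he⟩ : rightIdeal e), by
    change χ (e * algebraMap k A c) = c
    rw [map_mul, hχ, one_mul, AlgHom.commutes]; rfl⟩

theorem finite_charModule {k A : Type} [Field k] [Ring A] [Algebra k A]
    (χ : A →ₐ[k] k) {e : A} (he : e * e = e) (hχ : χ e = 1) :
    Module.Finite Aᵐᵒᵖ (CharModule χ) :=
  have := finite_rightIdeal he
  Module.Finite.of_surjective _ (charMap_surjective χ he hχ)

theorem hasProjectiveDimensionLT_charModule_iff {k A : Type} [Field k] [Ring A] [Algebra k A]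
    (χ : A →ₐ[k] k) {e : A} (he : e * e = e) (hχ : χ e = 1) {N : Type} [AddCommGroup N]
    [Module Aᵐᵒᵖ N] (f : N →ₗ[Aᵐᵒᵖ] rightIdeal e) (hf : Function.Injective f)
    (hker : ∀ x : rightIdeal e, χ x = 0 ↔ ∃ y, f y = x) (d : ℕ) :
    HasProjectiveDimensionLT (ModuleCat.of Aᵐᵒᵖ (CharModule χ)) (d + 2) ↔
      HasProjectiveDimensionLT (ModuleCat.of Aᵐᵒᵖ N) (d + 1) := by
  let S : ShortComplex (ModuleCat.{0} Aᵐᵒᵖ) :=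
    ShortComplex.mk (ModuleCat.ofHom f) (ModuleCat.ofHom (charMap χ e))
      (by ext y; exact (hker (f y)).2 ⟨y, rfl⟩)
  have hS : S.ShortExact := ModuleCat.shortComplex_shortExact S (fun x => hker x) hf
    (charMap_surjective χ he hχ)
  have := projective_rightIdeal he
  exact hS.hasProjectiveDimensionLT_X₃_iff d
    (inferInstanceAs (Projective (ModuleCat.of Aᵐᵒᵖ (rightIdeal e))))

theorem hasProjectiveDimensionLT_iff_of_equiv {R M N : Type} [Ring R] [AddCommGroup M]
    [AddCommGroup N] [Module R M] [Module R N] (e : M ≃ₗ[R] N) (d : ℕ) :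
    HasProjectiveDimensionLT (ModuleCat.of R M) d ↔
      HasProjectiveDimensionLT (ModuleCat.of R N) d :=
  ⟨fun _ => hasProjectiveDimensionLT_of_iso e.toModuleIso d,
    fun _ => hasProjectiveDimensionLT_of_iso e.symm.toModuleIso d⟩

end

namespace PathAlg

open MulOpposite

variable {k : Type} {m : ℕ} [Field k]

variable (k m) in
/-- The simple module at a vertex. -/
abbrev simpleAt (i : Option (Fin (m + 3))) : ModuleCat.{0} (PathAlg k m)ᵐᵒᵖ :=
  ModuleCat.of (PathAlg k m)ᵐᵒᵖ (CharModule (chi (k := k) i))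

theorem hasProjectiveDimensionLT_simpleAt_none :
    HasProjectiveDimensionLT (simpleAt k m none) 1 := by
  have := projective_rightIdeal (Es_mul_Es (k := k) (m := m))
  rw [← hasProjectiveDimensionLT_iff_of_equiv
    (LinearEquiv.ofBijective (charMap (chi (k := k) (m := m) none) Es) ⟨?_, ?_⟩),
    ← projective_iff_hasProjectiveDimensionLT_one]
  · infer_instance
  · rw [injective_iff_map_eq_zero]
    intro x (hx : x.1.es = 0)
    apply Subtype.ext
    rw [← mem_rightIdeal.1 x.2]
    ext <;> simp [hx]
  · exact charMap_surjective _ Es_mul_Es rfl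

theorem hasProjectiveDimensionLT_simpleAt_zero :
    HasProjectiveDimensionLT (simpleAt k m (some 0)) 2 := by
  have := projective_rightIdeal (E_mul_E (k := k) (m := m) 2)
  rw [hasProjectiveDimensionLT_charModule_iff _ (E_mul_E 0) (by simp)
    (leftMul (E 2) be E_mul_be) ?_ ?_, ← projective_iff_hasProjectiveDimensionLT_one]
  · infer_instance
  · rw [injective_iff_map_eq_zero]
    intro x hx
    have hx' : be * x.1 = 0 := congrArg Subtype.val hx
    apply Subtype.ext
    rw [← mem_rightIdeal.1 x.2]
    have h2 : x.1.e 2 = 0 := by simpa using congrArg PathAlg.b hx'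
    have h1 : x.1.a 1 = 0 := by simpa using congrArg PathAlg.p hx'
    have h3 : x.1.g = 0 := by simpa using congrArg PathAlg.q hx'
    ext j
    · by_cases h : j = 2 <;> simp [h, h2]
    · by_cases h : j = 1 <;> simp [h, h1, succ_eq_two]
    all_goals simp [h3, zero_ne_two]
  · intro x
    constructor
    · intro (hx : x.1.e 0 = 0)
      refine ⟨⟨⟨Pi.single 2 x.1.b, Pi.single 1 x.1.p, 0, 0, x.1.q, 0, 0⟩, ?_⟩, Subtype.ext ?_⟩
      · rw [mem_rightIdeal]
        ext j
        · by_cases h : j = 2 <;> simp [h]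
        · by_cases h : j = 1 <;> simp [h]
        all_goals simp [zero_ne_two]
      · rw [← mem_rightIdeal.1 x.2, leftMul_coe]
        ext j
        · by_cases h : j = 0 <;> simp [h, hx]
        all_goals simp [zero_ne_two.symm]
    · rintro ⟨y, rfl⟩
      simp

theorem not_hasProjectiveDimensionLT_simpleAt_zero :
    ¬ HasProjectiveDimensionLT (simpleAt k m (some 0)) 1 := by
  rw [← projective_iff_hasProjectiveDimensionLT_one]
  intro h
  have := (IsProjective.iff_projective _).2 h
  obtain ⟨s, hs⟩ := Module.projective_lifting_property
    (charMap (chi (k := k) (m := m) (some 0)) (E 0)) LinearMap.id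
    (charMap_surjective _ (E_mul_E 0) (by simp))
  let v : CharModule (chi (k := k) (m := m) (some 0)) := (1 : k)
  have h1 : (s v).1.e 0 = 1 := LinearMap.congr_fun hs v
  have h2 : op (be : PathAlg k m) • v = 0 := zero_mul (1 : k)
  have h3 : (s v).1 * be = 0 := by
    have := congrArg Subtype.val (s.map_smul (op be) v)
    rw [h2, map_zero] at this
    exact this.symm
  have h4 : (s v).1.e 0 = 0 := by simpa using congrArg PathAlg.b h3
  exact one_ne_zero (h1.symm.trans h4)

/-- The inclusion of a simple module spanned by an arrow of the chain. -/
def alMap (i : Fin (m + 2)) :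
    CharModule (chi (k := k) (some i.castSucc)) →ₗ[(PathAlg k m)ᵐᵒᵖ]
      rightIdeal (E (k := k) i.succ) :=
  eigenMap _ ⟨al i, E_mul_al i⟩ fun r => Subtype.ext <| by
    change al i * r = al i * algebraMap k _ (r.e i.castSucc)
    rw [algebraMap_mul']
    ext j
    · simp
    · by_cases h : j = i
      · subst h; simp
      · simp [h]
    all_goals simp

/-- The inclusion of the simple module spanned by the arrow from `2` to `s`. -/
def gaMap :
    CharModule (chi (k := k) (m := m) none) →ₗ[(PathAlg k m)ᵐᵒᵖ]
      rightIdeal (E (k := k) (m := m) 2) :=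
  eigenMap _ ⟨ga, E_mul_ga⟩ fun r => Subtype.ext <| by
    change ga * r = ga * algebraMap k _ r.es
    rw [algebraMap_mul']
    ext j <;> simp

theorem alMap_coe (i : Fin (m + 2)) (c : k) : (alMap (k := k) i c).1 = c • al i :=
  algebraMap_mul' c (al i)

theorem gaMap_coe (c : k) : (gaMap (k := k) (m := m) c).1 = c • ga :=
  algebraMap_mul' c ga

theorem alMap_injective (i : Fin (m + 2)) : Function.Injective (alMap (k := k) i) :=
  eigenMap_injective _ _ _ fun h => by
    have := congrArg (fun x : rightIdeal (E i.succ) => x.1.a i) h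
    simp at this

theorem hasProjectiveDimensionLT_simpleAt_succ_iff (i : Fin (m + 2)) (hi : i ≠ 1) (d : ℕ) :
    HasProjectiveDimensionLT (simpleAt k m (some i.succ)) (d + 2) ↔
      HasProjectiveDimensionLT (simpleAt k m (some i.castSucc)) (d + 1) := by
  refine hasProjectiveDimensionLT_charModule_iff _ (E_mul_E i.succ) (by simp) (alMap i)
    (alMap_injective i) (fun x => ⟨?_, ?_⟩) d
  · intro (hx : x.1.e i.succ = 0)
    refine ⟨x.1.a i, Subtype.ext ?_⟩
    rw [alMap_coe]
    conv_rhs => rw [← mem_rightIdeal.1 x.2]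
    have hi' : ¬ 2 = i.succ := fun h => hi ((succ_eq_two i).1 h.symm)
    ext j
    · by_cases h : j = i.succ <;> simp [h, hx]
    · by_cases h : j = i <;> simp [h]
    all_goals simp [hi', (Fin.succ_ne_zero i).symm]
  · rintro ⟨(c : k), rfl⟩
    rw [alMap_coe]
    simp

theorem hasProjectiveDimensionLT_simpleAt_two_iff (d : ℕ) :
    HasProjectiveDimensionLT (simpleAt k m (some 2)) (d + 2) ↔
      HasProjectiveDimensionLT (ModuleCat.of (PathAlg k m)ᵐᵒᵖ
        (CharModule (chi (k := k) (m := m) (some 1)) ×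
          CharModule (chi (k := k) (m := m) none))) (d + 1) := by
  refine hasProjectiveDimensionLT_charModule_iff _ (E_mul_E 2) (by simp)
    ((alMap (k := k) (m := m) 1).coprod gaMap) ?_ (fun x => ⟨?_, ?_⟩) d
  · rw [injective_iff_map_eq_zero]
    rintro ⟨(c : k), (c' : k)⟩ h
    have h' : c • (al 1 : PathAlg k m) + c' • ga = 0 := by
      rw [← alMap_coe, ← gaMap_coe]
      exact congrArg Subtype.val h
    have h1 : c = 0 := by simpa using congrArg (fun x => x.a 1) h'
    have h2 : c' = 0 := by simpa using congrArg PathAlg.g h'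
    subst h1 h2
    rfl
  · intro (hx : x.1.e 2 = 0)
    refine ⟨(x.1.a 1, x.1.g), Subtype.ext ?_⟩
    change (alMap (k := k) (m := m) 1 (x.1.a 1)).1 + (gaMap (k := k) (m := m) x.1.g).1 = x.1
    rw [alMap_coe, gaMap_coe]
    conv_rhs => rw [← mem_rightIdeal.1 x.2]
    ext j
    · by_cases h : j = 2 <;> simp [h, hx]
    · by_cases h : j = 1 <;> simp [h, succ_eq_two]
    all_goals simp [zero_ne_two]
  · rintro ⟨⟨(c : k), (c' : k)⟩, rfl⟩
    change ((alMap 1 c).1 + (gaMap c').1).e 2 = 0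
    rw [alMap_coe, gaMap_coe]
    simp

theorem hasProjectiveDimensionLT_simpleAt_two_iff' (d : ℕ) :
    HasProjectiveDimensionLT (simpleAt k m (some 2)) (d + 2) ↔
      HasProjectiveDimensionLT (simpleAt k m (some 1)) (d + 1) := by
  rw [hasProjectiveDimensionLT_simpleAt_two_iff]
  constructor
  · intro h
    exact Retract.hasProjectiveDimensionLT
      (⟨ModuleCat.ofHom (LinearMap.inl _ _ _), ModuleCat.ofHom (LinearMap.fst _ _ _), by
        ext; rfl⟩ : Retract (simpleAt k m (some 1)) (ModuleCat.of (PathAlg k m)ᵐᵒᵖ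
          (CharModule (chi (k := k) (m := m) (some 1)) ×
            CharModule (chi (k := k) (m := m) none)))) (d + 1)
  · intro h
    have := hasProjectiveDimensionLT_simpleAt_none (k := k) (m := m)
    have := hasProjectiveDimensionLT_of_ge (simpleAt k m none) 1 (d + 1) (by lia)
    exact hasProjectiveDimensionLT_of_iso
      (ModuleCat.biprodIsoProd (simpleAt k m (some 1)) (simpleAt k m none)) (d + 1)

theorem hasProjectiveDimensionLT_simpleAt_succ_iff' (i : Fin (m + 2)) (d : ℕ) :
    HasProjectiveDimensionLT (simpleAt k m (some i.succ)) (d + 2) ↔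
      HasProjectiveDimensionLT (simpleAt k m (some i.castSucc)) (d + 1) := by
  by_cases hi : i = 1
  · subst hi
    exact hasProjectiveDimensionLT_simpleAt_two_iff' d
  · exact hasProjectiveDimensionLT_simpleAt_succ_iff i hi d

theorem hasProjectiveDimensionLT_simpleAt (j : Fin (m + 3)) :
    HasProjectiveDimensionLT (simpleAt k m (some j)) (j.val + 2) ∧
      ¬ HasProjectiveDimensionLT (simpleAt k m (some j)) (j.val + 1) := by
  induction j using Fin.induction with
  | zero =>
    exact ⟨hasProjectiveDimensionLT_simpleAt_zero, not_hasProjectiveDimensionLT_simpleAt_zero⟩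
  | succ i ih =>
    rw [← hasProjectiveDimensionLT_simpleAt_succ_iff',
      ← hasProjectiveDimensionLT_simpleAt_succ_iff'] at ih
    exact ih

instance : IsArtinianRing (PathAlg k m)ᵐᵒᵖ := IsArtinianRing.of_finite k _

theorem gldLE_pathAlg : gldLE.{0, 0} (PathAlg k m)ᵐᵒᵖ (m + 3) := by
  refine gldLE_of_simples _ fun N _ _ _ => ?_
  obtain ⟨i, ⟨f⟩⟩ := exists_charModule_equiv (chi (k := k) (m := m)) idem chi_idem cube_eq_zero N
  rw [← hasProjectiveDimensionLT_iff_of_equiv f]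
  cases i with
  | none =>
    have := hasProjectiveDimensionLT_simpleAt_none (k := k) (m := m)
    exact hasProjectiveDimensionLT_of_ge _ 1 _ (by lia)
  | some j =>
    have := (hasProjectiveDimensionLT_simpleAt (k := k) j).1
    exact hasProjectiveDimensionLT_of_ge _ (j.val + 2) _ (by lia)

theorem not_gldLE_pathAlg : ¬ gldLE.{0, 0} (PathAlg k m)ᵐᵒᵖ (m + 2) := by
  intro h
  have hfin := finite_charModule (chi (k := k) (some (Fin.last (m + 2))))
    (E_mul_E (Fin.last (m + 2))) (by simp)
  exact (hasProjectiveDimensionLT_simpleAt (k := k) (Fin.last (m + 2))).2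
    ((pdLE_iff_hasProjectiveDimensionLT _ _).1
      (h (simpleAt k m (some (Fin.last (m + 2)))) hfin))

end PathAlg

section

open MulOpposite

variable {A : Type} [Ring A]

/-- The map from a right ideal `e A` sending `e` to `n e`. -/
def smulMap (e : A) {N : Type} [AddCommGroup N] [Module Aᵐᵒᵖ N] (n : N) :
    rightIdeal e →ₗ[Aᵐᵒᵖ] N :=
  (LinearMap.toSpanSingleton Aᵐᵒᵖ N n).comp
    ((regularEquiv A).toLinearMap.comp (rightIdeal e).subtype)

@[simp]
theorem smulMap_apply (e : A) {N : Type} [AddCommGroup N] [Module Aᵐᵒᵖ N] (n : N)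
    (z : rightIdeal e) : smulMap e n z = op z.1 • n := rfl

@[simp]
theorem coe_op_smul {e : A} (r : A) (z : rightIdeal e) : (op r • z).1 = z.1 * r := rfl

theorem rightIdeal_hom_ext {e : A} (he : e * e = e) {N : Type} [AddCommGroup N] [Module Aᵐᵒᵖ N]
    {φ ψ : rightIdeal e →ₗ[Aᵐᵒᵖ] N} (h : φ ⟨e, he⟩ = ψ ⟨e, he⟩) : φ = ψ := by
  ext x
  have : x = op x.1 • (⟨e, he⟩ : rightIdeal e) := Subtype.ext (mem_rightIdeal.1 x.2).symm
  rw [this, map_smul, map_smul, h]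

theorem rightIdeal_prod_hom_ext {e : A} (he : e * e = e) {N : Type} [AddCommGroup N]
    [Module Aᵐᵒᵖ N] {φ ψ : rightIdeal e × rightIdeal e →ₗ[Aᵐᵒᵖ] N}
    (h : φ (⟨e, he⟩, 0) = ψ (⟨e, he⟩, 0)) (h' : φ (0, ⟨e, he⟩) = ψ (0, ⟨e, he⟩)) : φ = ψ :=
  LinearMap.prod_ext (rightIdeal_hom_ext he h) (rightIdeal_hom_ext he h')

end

namespace PathAlg

open MulOpposite

variable {k : Type} {m : ℕ} [Field k]

/-- The idempotent at `s` and `0`. -/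
@[simps]
def idF : PathAlg k m := ⟨Pi.single 0 1, 0, 1, 0, 0, 0, 0⟩

/-- The idempotent at `1, …, m + 2`. -/
@[simps]
def idG : PathAlg k m := ⟨1 - Pi.single 0 1, 0, 0, 0, 0, 0, 0⟩

/-- The sum of the arrows from `1` to `0` and from `2` to `s`. -/
@[simps]
def de : PathAlg k m := ⟨0, Pi.single 0 1, 0, 0, 1, 0, 0⟩

theorem idF_mul_idF : (idF * idF : PathAlg k m) = idF := by
  ext j <;> simp [Pi.single_apply]

theorem idG_mul_idG : (idG * idG : PathAlg k m) = idG := by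
  ext j
  · by_cases h : j = 0 <;> simp [h]
  all_goals simp

theorem idF_add_idG : (idF + idG : PathAlg k m) = 1 := by
  ext j <;> simp

theorem idG_mul_de : (idG * de : PathAlg k m) = de := by
  ext j
  · simp
  · by_cases h : j = 0 <;> simp [h]
  all_goals simp [zero_ne_two.symm]

variable (k m) in
/-- The generator of the right ideal of `idF`. -/
abbrev genF : rightIdeal (idF : PathAlg k m) := ⟨idF, idF_mul_idF⟩

variable (k m) in
/-- The generator of the right ideal of `idG`. -/
abbrev genG : rightIdeal (idG : PathAlg k m) := ⟨idG, idG_mul_idG⟩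

variable (k m) in
/-- The right ideal of `idF` as an object. -/
abbrev objF : ModuleCat.{0} (PathAlg k m)ᵐᵒᵖ :=
  ModuleCat.of _ (rightIdeal (idF : PathAlg k m))

variable (k m) in
/-- The degree `-1` term of the silting complex. -/
abbrev X₀ : ModuleCat.{0} (PathAlg k m)ᵐᵒᵖ :=
  ModuleCat.of _ (rightIdeal (idF : PathAlg k m) × rightIdeal (idF : PathAlg k m))

variable (k m) in
/-- The degree `0` term of the silting complex. -/
abbrev X₁ : ModuleCat.{0} (PathAlg k m)ᵐᵒᵖ :=
  ModuleCat.of _ (rightIdeal (idG : PathAlg k m))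

variable (k m) in
/-- The differential of the silting complex, as a linear map. -/
def diffLin : rightIdeal (idF : PathAlg k m) × rightIdeal (idF : PathAlg k m) →ₗ[(PathAlg k m)ᵐᵒᵖ]
    rightIdeal (idG : PathAlg k m) :=
  (smulMap idF ⟨de, idG_mul_de⟩).comp (LinearMap.snd _ _ _)

@[simp]
theorem diffLin_apply (z : rightIdeal (idF : PathAlg k m) × rightIdeal (idF : PathAlg k m)) :
    (diffLin k m z).1 = de * z.2.1 := rfl

variable (k m) in
/-- The differential of the silting complex. -/
abbrev diff : X₀ k m ⟶ X₁ k m := ModuleCat.ofHom (diffLin k m)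

instance : Module.Projective (PathAlg k m)ᵐᵒᵖ (rightIdeal (idF : PathAlg k m)) :=
  projective_rightIdeal idF_mul_idF

instance : Module.Projective (PathAlg k m)ᵐᵒᵖ (rightIdeal (idG : PathAlg k m)) :=
  projective_rightIdeal idG_mul_idG

instance : Module.Finite (PathAlg k m)ᵐᵒᵖ (rightIdeal (idF : PathAlg k m)) :=
  finite_rightIdeal idF_mul_idF

instance : Module.Finite (PathAlg k m)ᵐᵒᵖ (rightIdeal (idG : PathAlg k m)) :=
  finite_rightIdeal idG_mul_idG

/-- An element of `F A F`. -/
@[simps]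
def ff (x y z : k) : PathAlg k m := ⟨Pi.single 0 y, 0, x, 0, 0, 0, z⟩

theorem idF_mul_ff (x y z : k) : (idF * ff x y z : PathAlg k m) = ff x y z := by
  ext j
  · by_cases h : j = 0 <;> simp [h]
  all_goals simp

theorem ff_mul_idF (x y z : k) : (ff x y z * idF : PathAlg k m) = ff x y z := by
  ext j
  · by_cases h : j = 0 <;> simp [h]
  all_goals simp

theorem eq_de_mul_ff {x : PathAlg k m} (hx : idG * x = x) (hx' : x * idF = x) :
    x = de * ff x.g (x.a 0) 0 := by
  rw [← hx', ← hx]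
  ext j
  · by_cases h : j = 0 <;> simp [h]
  · by_cases h : j = 0 <;> simp [h]
  all_goals simp [zero_ne_two.symm]

theorem op_idF_smul_genF : op (idF : PathAlg k m) • genF k m = genF k m :=
  Subtype.ext idF_mul_idF

theorem exists_eq_comp_diff (f : X₀ k m ⟶ X₁ k m) : ∃ s, f = s ≫ diff k m := by
  have key (z : X₀ k m) (hz : op (idF : PathAlg k m) • z = z) :
      (f z).1 = de * ff (f z).1.g ((f z).1.a 0) 0 :=
    eq_de_mul_ff (mem_rightIdeal.1 (f z).2) (by rw [← coe_op_smul, ← map_smul, hz])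
  let y (z : X₀ k m) : rightIdeal (idF : PathAlg k m) :=
    ⟨ff (f z).1.g ((f z).1.a 0) 0, idF_mul_ff _ _ _⟩
  refine ⟨ModuleCat.ofHom (LinearMap.inr _ _ _ ∘ₗ
    (smulMap idF (y (genF k m, 0))).coprod (smulMap idF (y (0, genF k m)))), ?_⟩
  ext : 1
  refine rightIdeal_prod_hom_ext idF_mul_idF (Subtype.ext ?_) (Subtype.ext ?_)
  · refine (key _ (Prod.ext op_idF_smul_genF (smul_zero _))).trans ?_
    change _ = de * (ff _ _ _ * idF + ff _ _ _ * (0 : PathAlg k m))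
    rw [mul_zero, add_zero, ff_mul_idF]
  · refine (key _ (Prod.ext (smul_zero _) op_idF_smul_genF)).trans ?_
    change _ = de * (ff _ _ _ * (0 : PathAlg k m) + ff _ _ _ * idF)
    rw [mul_zero, zero_add, ff_mul_idF]

theorem isTwoTermSilting_diff [HasDerivedCategory.{w} (ModuleCat.{0} (PathAlg k m)ᵐᵒᵖ)] :
    IsTwoTermSilting (PathAlg k m)ᵐᵒᵖ (twoTerm (diff k m)) :=
  isTwoTermSilting_twoTerm (M := objF k m)
    (inferInstanceAs (Module.Finite _ (_ × _))) inferInstance (diff k m) exists_eq_comp_diff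
    (ModuleCat.ofHom (LinearMap.inl _ _ _)) (ModuleCat.ofHom (LinearMap.fst _ _ _))
    (by ext : 2; rfl) (by ext x : 2; exact Subtype.ext (mul_zero de))
    (ModuleCat.biprodIsoProd (objF k m) (objF k m)).symm
    (ModuleCat.biprodIsoProd (objF k m) (X₁ k m) ≪≫
      ((peirceEquiv idF_mul_idF idG_mul_idG idF_add_idG).trans (regularEquiv _)).toModuleIso)

end PathAlg

namespace PathAlg

open MulOpposite

/-- The parameters of an element of a corner of the endomorphism algebra of `twoTerm (diff k m)`. -/
structure Corner (k : Type) where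
  /-- The coefficient of `Es` in position `(1, 1)`. -/
  a : k
  /-- The coefficient of `q` in position `(1, 2)`. -/
  c : k
  /-- The coefficient of `Es` in position `(2, 1)`. -/
  r : k
  /-- The coefficient of `Es` in position `(2, 2)`. -/
  x : k
  /-- The coefficient of `E 0` in position `(2, 2)`. -/
  y : k
  /-- The coefficient of `q` in position `(2, 2)`. -/
  z : k
  /-- The coefficient of the arrow from `2` to `1` in degree `0`. -/
  w : k

variable {k : Type} {m : ℕ} [Field k]

/-- An element of `idF A idF` as an element of the right ideal of `idF`. -/
def ffF (x y z : k) : rightIdeal (idF : PathAlg k m) := ⟨ff x y z, idF_mul_ff x y z⟩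

@[simp]
theorem ffF_coe (x y z : k) : (ffF x y z : rightIdeal (idF : PathAlg k m)).1 = ff x y z := rfl

theorem ff_mul_ff (x y z x' y' z' : k) :
    (ff x y z * ff x' y' z' : PathAlg k m) = ff (x * x') (y * y') (y * z' + z * x') := by
  ext j
  · by_cases h : j = 0 <;> simp [h]
  all_goals simp

theorem ff_add_ff (x y z x' y' z' : k) :
    (ff x y z + ff x' y' z' : PathAlg k m) = ff (x + x') (y + y') (z + z') := by
  ext j
  · by_cases h : j = 0 <;> simp [h]
  all_goals simp

theorem eq_ff {u : PathAlg k m} (hu : idF * u = u) (hu' : u * idF = u) :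
    u = ff u.es (u.e 0) u.q := by
  rw [← hu', ← hu]
  ext j
  · by_cases h : j = 0 <;> simp [h]
  all_goals simp [zero_ne_two.symm]

/-- An element of the corner of `idG A idG` at the vertices `1` and `2`. -/
@[simps]
def vv (x y w : k) : PathAlg k m :=
  ⟨Pi.single 1 y + Pi.single 2 x, Pi.single 1 w, 0, 0, 0, 0, 0⟩

theorem one_ne_two : (1 : Fin (m + 3)) ≠ 2 := by simp [Fin.ext_iff, Nat.mod_eq_of_lt]

theorem vv_mul_vv (x y w x' y' w' : k) :
    (vv x y w * vv x' y' w' : PathAlg k m) = vv (x * x') (y * y') (x * w' + w * y') := by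
  ext j
  · by_cases h : j = 1
    · simp [h, one_ne_two]
    · by_cases h' : j = 2 <;> simp [h, h', one_ne_two.symm]
  · by_cases h : j = 1
    · simp [h, one_ne_two, one_ne_two.symm]
    · simp [h]
  all_goals simp

theorem vv_mul {v : PathAlg k m} (hv : v * idG = v) :
    vv 1 1 0 * v = vv (v.e 2) (v.e 1) (v.a 1) := by
  rw [← hv]
  ext j
  · by_cases h : j = 1
    · simp [h, one_ne_two]
    · by_cases h' : j = 2 <;> simp [h, h', zero_ne_two.symm, one_ne_two.symm]
  · rcases eq_or_ne j 1 with rfl | h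
    · simp [one_ne_two.symm]
    · rcases eq_or_ne j 0 with rfl | h'
      · simp
      · have h1 : j.succ ≠ 1 := fun e => h' (Fin.succ_injective _ e)
        have h2 : j.succ ≠ 2 := fun e => h ((succ_eq_two j).1 e)
        simp [h, h1, h2]
  all_goals simp [zero_ne_two]

theorem idG_mul_vv (x y w : k) : (idG * vv x y w : PathAlg k m) = vv x y w := by
  ext j
  · by_cases h : j = 0 <;> simp [h, zero_ne_two]
  · by_cases h : j = 1 <;> simp [h, zero_ne_two.symm]
  all_goals simp

/-- An element of the corner of `idG A idG` as an element of the right ideal of `idG`. -/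
def vvG (x y w : k) : rightIdeal (idG : PathAlg k m) := ⟨vv x y w, idG_mul_vv x y w⟩

@[simp]
theorem vvG_coe (x y w : k) : (vvG x y w : rightIdeal (idG : PathAlg k m)).1 = vv x y w := rfl

namespace Corner

variable (m) in
/-- The degree `-1` component of an endomorphism. -/
def top (t : Corner k) : X₀ k m ⟶ X₀ k m :=
  ModuleCat.ofHom ((smulMap idF (ffF t.a 0 0, ffF 0 0 t.c)).coprod
    (smulMap idF (ffF t.r 0 0, ffF t.x t.y t.z)))

variable (m) in
/-- The degree `0` component of an endomorphism. -/
def bot (t : Corner k) : X₁ k m ⟶ X₁ k m := ModuleCat.ofHom (smulMap idG (vvG t.x t.y t.w))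

theorem top_apply (t : Corner k) (u : X₀ k m) :
    top m t u = (op u.1.1 • ffF t.a 0 0 + op u.2.1 • ffF t.r 0 0,
      op u.1.1 • ffF 0 0 t.c + op u.2.1 • ffF t.x t.y t.z) := rfl

theorem bot_apply (t : Corner k) (u : X₁ k m) : bot m t u = op u.1 • vvG t.x t.y t.w := rfl

theorem top_comp_diff (t : Corner k) : top m t ≫ diff k m = diff k m ≫ bot m t := by
  ext : 1
  refine rightIdeal_prod_hom_ext idF_mul_idF (Subtype.ext ?_) (Subtype.ext ?_)
  · change de * (ff 0 0 t.c * idF + ff t.x t.y t.z * (0 : PathAlg k m)) =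
      vv t.x t.y t.w * (de * (0 : PathAlg k m))
    ext j <;> simp
  · change de * (ff 0 0 t.c * (0 : PathAlg k m) + ff t.x t.y t.z * idF) =
      vv t.x t.y t.w * (de * idF)
    ext j
    · simp
    · by_cases h : j = 0 <;> simp [h, one_ne_two]
    all_goals simp [one_ne_two.symm]

variable (m) in
/-- The endomorphism with given parameters. -/
def el (t : Corner k) : ArrowEnd (diff k m) := ⟨(top m t, bot m t), top_comp_diff t⟩

instance : Mul (Corner k) where
  mul s t :=
    { a := s.a * t.a
      c := t.c * s.a + t.y * s.c
      r := t.a * s.r + t.r * s.x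
      x := s.x * t.x
      y := s.y * t.y
      z := t.c * s.r + t.y * s.z + t.z * s.x
      w := t.x * s.w + t.w * s.y }

@[simp] theorem mul_a (s t : Corner k) : (s * t).a = s.a * t.a := rfl
@[simp] theorem mul_c (s t : Corner k) : (s * t).c = t.c * s.a + t.y * s.c := rfl
@[simp] theorem mul_r (s t : Corner k) : (s * t).r = t.a * s.r + t.r * s.x := rfl
@[simp] theorem mul_x (s t : Corner k) : (s * t).x = s.x * t.x := rfl
@[simp] theorem mul_y (s t : Corner k) : (s * t).y = s.y * t.y := rfl
@[simp] theorem mul_z (s t : Corner k) : (s * t).z = t.c * s.r + t.y * s.z + t.z * s.x := rfl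
@[simp] theorem mul_w (s t : Corner k) : (s * t).w = t.x * s.w + t.w * s.y := rfl

theorem op_idF_smul_ffF (x y z : k) :
    op (idF : PathAlg k m) • ffF x y z = (ffF x y z : rightIdeal (idF : PathAlg k m)) :=
  Subtype.ext (ff_mul_idF x y z)

theorem vv_mul_idG (x y w : k) : (vv x y w * idG : PathAlg k m) = vv x y w := by
  ext j
  · by_cases h : j = 0 <;> simp [h, zero_ne_two]
  · by_cases h : j = 1 <;> simp [h]
  all_goals simp

theorem top_left (t : Corner k) : top m t (genF k m, 0) = (ffF t.a 0 0, ffF 0 0 t.c) := by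
  rw [top_apply]
  simp [op_idF_smul_ffF]

theorem top_right (t : Corner k) : top m t (0, genF k m) = (ffF t.r 0 0, ffF t.x t.y t.z) := by
  rw [top_apply]
  simp [op_idF_smul_ffF]

theorem bot_gen (t : Corner k) : bot m t (genG k m) = vvG t.x t.y t.w :=
  Subtype.ext (vv_mul_idG _ _ _)

theorem diff_left : diff k m (genF k m, 0) = 0 := Subtype.ext (mul_zero de)

theorem diff_right : diff k m (0, genF k m) = op (de : PathAlg k m) • genG k m := by
  refine Subtype.ext ?_
  change de * idF = idG * de
  ext j
  · simp
  · by_cases h : j = 0 <;> simp [h]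
  all_goals simp [zero_ne_two.symm]

theorem top_mul (s t : Corner k) : top m s ≫ top m t = top m (s * t) := by
  ext : 1
  refine rightIdeal_prod_hom_ext idF_mul_idF ?_ ?_
  · change top m t (top m s (genF k m, 0)) = top m (s * t) (genF k m, 0)
    rw [top_left, top_left, top_apply]
    refine Prod.ext (Subtype.ext ?_) (Subtype.ext ?_)
    · change ff _ _ _ * ff _ _ _ + ff _ _ _ * ff _ _ _ = ff _ _ _
      simp [ff_mul_ff, ff_add_ff, mul_comm]
    · change ff _ _ _ * ff _ _ _ + ff _ _ _ * ff _ _ _ = ff _ _ _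
      simp [ff_mul_ff, ff_add_ff]
  · change top m t (top m s (0, genF k m)) = top m (s * t) (0, genF k m)
    rw [top_right, top_right, top_apply]
    refine Prod.ext (Subtype.ext ?_) (Subtype.ext ?_)
    · change ff _ _ _ * ff _ _ _ + ff _ _ _ * ff _ _ _ = ff _ _ _
      simp [ff_mul_ff, ff_add_ff]
    · change ff _ _ _ * ff _ _ _ + ff _ _ _ * ff _ _ _ = ff _ _ _
      simp [ff_mul_ff, ff_add_ff, mul_comm t.x, mul_comm t.y, add_assoc]

theorem bot_mul (s t : Corner k) : bot m s ≫ bot m t = bot m (s * t) := by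
  ext : 1
  refine rightIdeal_hom_ext idG_mul_idG (Subtype.ext ?_)
  change (bot m t (bot m s (genG k m))).1 = (bot m (s * t) (genG k m)).1
  rw [bot_gen, bot_gen, bot_apply]
  change vv _ _ _ * vv _ _ _ = vv _ _ _
  simp [vv_mul_vv, mul_comm t.x, mul_comm t.y]

variable [HasDerivedCategory.{w} (ModuleCat.{0} (PathAlg k m)ᵐᵒᵖ)]

variable (m) in
/-- The class of an endomorphism in the derived category. -/
def cls (t : Corner k) : (End (DerivedCategory.Q.obj (twoTerm (diff k m))))ᵐᵒᵖ :=
  toEndOp (diff k m) (el m t)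

theorem cls_mul (s t : Corner k) : cls m s * cls m t = cls m (s * t) :=
  toEndOp_mul _ (top_mul s t) (bot_mul s t)

theorem cls_eq_iff (s t : Corner k) : cls m s = cls m t ↔
    s.a = t.a ∧ s.c = t.c ∧ s.r = t.r ∧ s.x = t.x ∧ s.y = t.y ∧ s.w = t.w := by
  rw [cls, cls, toEndOp_eq_iff]
  constructor
  · rintro ⟨h, h0, h1⟩
    have hl : top m s (genF k m, 0) - top m t (genF k m, 0) = h (diff k m (genF k m, 0)) :=
      congrArg (fun φ => φ (genF k m, 0)) h0
    have hr : top m s (0, genF k m) - top m t (0, genF k m) = h (diff k m (0, genF k m)) :=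
      congrArg (fun φ => φ (0, genF k m)) h0
    have hb : bot m s (genG k m) - bot m t (genG k m) = diff k m (h (genG k m)) :=
      congrArg (fun φ => φ (genG k m)) h1
    rw [diff_left, map_zero, top_left, top_left] at hl
    rw [diff_right, map_smul, top_right, top_right] at hr
    rw [bot_gen, bot_gen] at hb
    generalize h (genG k m) = p at hr hb
    have h11 : (ff s.a 0 0 - ff t.a 0 0 : PathAlg k m) = 0 :=
      congrArg (fun u : X₀ k m => u.1.1) hl
    have h12 : (ff 0 0 s.c - ff 0 0 t.c : PathAlg k m) = 0 :=
      congrArg (fun u : X₀ k m => u.2.1) hl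
    have h21 : (ff s.r 0 0 - ff t.r 0 0 : PathAlg k m) = p.1.1 * de :=
      congrArg (fun u : X₀ k m => u.1.1) hr
    have h22 : (ff s.x s.y s.z - ff t.x t.y t.z : PathAlg k m) = p.2.1 * de :=
      congrArg (fun u : X₀ k m => u.2.1) hr
    have hv : (vv s.x s.y s.w - vv t.x t.y t.w : PathAlg k m) = de * p.2.1 :=
      congrArg Subtype.val hb
    refine ⟨sub_eq_zero.1 ?_, sub_eq_zero.1 ?_, sub_eq_zero.1 ?_, sub_eq_zero.1 ?_,
      sub_eq_zero.1 ?_, sub_eq_zero.1 ?_⟩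
    · simpa using congrArg PathAlg.es h11
    · simpa using congrArg PathAlg.q h12
    · simpa using congrArg PathAlg.es h21
    · simpa using congrArg PathAlg.es h22
    · simpa using congrArg (fun u => PathAlg.e u 0) h22
    · simpa using congrArg (fun u => PathAlg.a u 1) hv
  · rintro ⟨ha, hc, hr, hx, hy, hw⟩
    refine ⟨ModuleCat.ofHom (smulMap idG (0, op ((s.z - t.z) • (be : PathAlg k m)) • genF k m)), ?_, ?_⟩
    · ext : 1
      refine rightIdeal_prod_hom_ext idF_mul_idF ?_ ?_
      · change top m s (genF k m, 0) - top m t (genF k m, 0) =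
          op (diff k m (genF k m, 0)).1 • ((0, op ((s.z - t.z) • (be : PathAlg k m)) • genF k m) : X₀ k m)
        rw [diff_left, top_left, top_left, ha, hc, sub_self]
        exact (zero_smul _ _).symm
      · change top m s (0, genF k m) - top m t (0, genF k m) =
          op (diff k m (0, genF k m)).1 • ((0, op ((s.z - t.z) • (be : PathAlg k m)) • genF k m) : X₀ k m)
        rw [diff_right, top_right, top_right, hr, hx, hy]
        refine Prod.ext (Subtype.ext ?_) (Subtype.ext ?_) <;> ext j
        all_goals simp [zero_ne_two.symm]
    · ext : 1
      refine rightIdeal_hom_ext idG_mul_idG (Subtype.ext ?_)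
      change (bot m s (genG k m)).1 - (bot m t (genG k m)).1 =
        de * (idF * ((s.z - t.z) • (be : PathAlg k m)) * idG)
      rw [bot_gen, bot_gen, hx, hy, hw, sub_self]
      ext j <;> simp

theorem exists_cls_eq (c : (End (DerivedCategory.Q.obj (twoTerm (diff k m))))ᵐᵒᵖ) :
    ∃ t, c * cls m ⟨1, 0, 0, 1, 1, 0, 0⟩ = cls m t := by
  obtain ⟨c, rfl⟩ := toEndOp_surjective _ c
  have hc (u : X₀ k m) : diff k m (c.1.1 u) = c.1.2 (diff k m u) :=
    congrArg (fun φ => φ u) c.2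
  have hl : op (idF : PathAlg k m) • c.1.1 (genF k m, 0) = c.1.1 (genF k m, 0) := by
    rw [← map_smul, Prod.smul_mk, op_idF_smul_genF, smul_zero]
  have hr : op (idF : PathAlg k m) • c.1.1 (0, genF k m) = c.1.1 (0, genF k m) := by
    rw [← map_smul, Prod.smul_mk, op_idF_smul_genF, smul_zero]
  have hv : op (idG : PathAlg k m) • c.1.2 (genG k m) = c.1.2 (genG k m) := by
    rw [← map_smul]
    exact congrArg _ (Subtype.ext idG_mul_idG)
  have hcl := hc (genF k m, 0)
  have hcr := hc (0, genF k m)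
  rw [diff_left, map_zero] at hcl
  rw [diff_right, map_smul] at hcr
  obtain ⟨⟨⟨u11, h11⟩, ⟨u12, h12⟩⟩, hu⟩ : ∃ u, u = c.1.1 (genF k m, 0) := ⟨_, rfl⟩
  obtain ⟨⟨⟨u21, h21⟩, ⟨u22, h22⟩⟩, hu'⟩ : ∃ u, u = c.1.1 (0, genF k m) := ⟨_, rfl⟩
  obtain ⟨⟨v, hv'⟩, hw⟩ : ∃ v, v = c.1.2 (genG k m) := ⟨_, rfl⟩
  rw [← hu] at hl hcl
  rw [← hu'] at hr hcr
  rw [← hw] at hv hcr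
  have e11 := eq_ff h11 (congrArg (fun u : X₀ k m => u.1.1) hl)
  have e12 := eq_ff h12 (congrArg (fun u : X₀ k m => u.2.1) hl)
  have e21 := eq_ff h21 (congrArg (fun u : X₀ k m => u.1.1) hr)
  have e22 := eq_ff h22 (congrArg (fun u : X₀ k m => u.2.1) hr)
  have ev := vv_mul (congrArg Subtype.val hv)
  have hcl' : de * u12 = 0 := congrArg Subtype.val hcl
  have hcr' : de * u22 = v * de := congrArg Subtype.val hcr
  have z1 : u12.es = 0 := by simpa using congrArg PathAlg.g hcl'
  have z2 : u12.e 0 = 0 := by simpa using congrArg (fun u => PathAlg.a u 0) hcl'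
  have z3 : u22.es = v.e 2 := by simpa using congrArg PathAlg.g hcr'
  have z4 : u22.e 0 = v.e 1 := by simpa using congrArg (fun u => PathAlg.a u 0) hcr'
  rw [z1, z2] at e12
  rw [z3, z4] at e22
  refine ⟨⟨u11.es, u12.q, u21.es, v.e 2, v.e 1, u22.q, v.a 1⟩, toEndOp_mul _ ?_ ?_⟩
  · ext : 1
    refine rightIdeal_prod_hom_ext idF_mul_idF ?_ ?_
    · change top m _ (c.1.1 (genF k m, 0)) = top m _ (genF k m, 0)
      rw [top_left, ← hu, top_apply]
      refine Prod.ext (Subtype.ext ?_) (Subtype.ext ?_)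
      · change ff 1 0 0 * u11 + ff 0 0 0 * u12 = ff u11.es 0 0
        rw [e11, e12]
        simp [ff_mul_ff, ff_add_ff]
      · change ff 0 0 0 * u11 + ff 1 1 0 * u12 = ff 0 0 u12.q
        rw [e11, e12]
        simp [ff_mul_ff, ff_add_ff]
    · change top m _ (c.1.1 (0, genF k m)) = top m _ (0, genF k m)
      rw [top_right, ← hu', top_apply]
      refine Prod.ext (Subtype.ext ?_) (Subtype.ext ?_)
      · change ff 1 0 0 * u21 + ff 0 0 0 * u22 = ff u21.es 0 0
        rw [e21, e22]
        simp [ff_mul_ff, ff_add_ff]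
      · change ff 0 0 0 * u21 + ff 1 1 0 * u22 = ff (v.e 2) (v.e 1) u22.q
        rw [e21, e22]
        simp [ff_mul_ff, ff_add_ff]
  · ext : 1
    refine rightIdeal_hom_ext idG_mul_idG (Subtype.ext ?_)
    change (bot m _ (c.1.2 (genG k m))).1 = (bot m _ (genG k m)).1
    rw [bot_gen, ← hw]
    exact ev

end Corner

end PathAlg

namespace PathAlg

namespace Corner

variable {k : Type} {m : ℕ} [Field k]

theorem cls_zero [HasDerivedCategory.{w} (ModuleCat.{0} (PathAlg k m)ᵐᵒᵖ)] (z : k) :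
    cls m ⟨0, 0, 0, 0, 0, z, 0⟩ = 0 := by
  have h := exists_cls_eq (k := k) (m := m) 0
  rw [zero_mul] at h
  obtain ⟨t, ht⟩ := h
  have h0 : cls m t * cls m ⟨0, 0, 0, 0, 0, z, 0⟩ = cls m ⟨0, 0, 0, 0, 0, z, 0⟩ := by
    rw [cls_mul, cls_eq_iff]
    simp
  rw [← h0, ← ht, zero_mul]

theorem not_gldLE_end [HasDerivedCategory.{1} (ModuleCat.{0} (PathAlg k m)ᵐᵒᵖ)] (d : ℕ) :
    ¬ gldLE.{1, 1} (End (DerivedCategory.Q.obj (twoTerm (diff k m))))ᵐᵒᵖ d := by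
  have hz := cls_zero (k := k) (m := m)
  refine not_gldLE_of_periodic_cyclic (cls m ⟨0, 1, 1, 0, 0, 0, 1⟩) (cls m ⟨1, 0, 0, 1, 1, 0, 0⟩)
    ?_ ?_ ?_ ?_ ?_ ?_ ?_ d
  · rw [cls_mul, cls_eq_iff]
    simp
  · rw [cls_mul, cls_eq_iff]
    simp
  · rw [cls_mul, cls_eq_iff]
    simp
  · rw [cls_mul, ← hz 0, cls_eq_iff]
    simp
  · rw [← hz 0, Ne, cls_eq_iff]
    simp
  · intro c hc hcx
    obtain ⟨t, ht⟩ := exists_cls_eq c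
    rw [← hc, ht, cls_mul, ← hz 0, cls_eq_iff] at hcx
    refine ⟨cls m ⟨t.c, 0, 0, t.r, t.w, 0, 0⟩, ?_⟩
    rw [← hc, ht, cls_mul, cls_eq_iff]
    simp at hcx ⊢
    exact ⟨hcx.1, hcx.2.1, hcx.2.2⟩
  · intro c
    obtain ⟨t, ht⟩ := exists_cls_eq c
    have he : cls m ⟨1, 0, 0, 1, 1, 0, 0⟩ * cls m ⟨0, 1, 1, 0, 0, 0, 1⟩ =
        cls (k := k) m ⟨0, 1, 1, 0, 0, 0, 1⟩ := by
      rw [cls_mul, cls_eq_iff]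
      simp
    rw [← he, mul_assoc, mul_assoc, ← mul_assoc c, ht, cls_mul, cls_mul, cls_mul, ← hz 0,
      cls_eq_iff]
    simp

end Corner

end PathAlg

theorem nonempty_siltingWitness (k : Type) [Field k] (m : ℕ) :
    Nonempty (SiltingWitness k (m + 3)) := by
  let _ := HasDerivedCategory.standard (ModuleCat.{0} (PathAlg k m)ᵐᵒᵖ)
  exact ⟨{
    A := PathAlg k m
    P := twoTerm (PathAlg.diff k m)
    silting := PathAlg.isTwoTermSilting_diff
    gld_le := PathAlg.gldLE_pathAlg
    gld_ge := PathAlg.not_gldLE_pathAlg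
    endo_infinite := PathAlg.Corner.not_gldLE_end }⟩

/-- For every integer `n > 2` there is a finite dimensional `k`-algebra `A`
with `gl.dim A = n` and a 2-term silting complex `P` in `K^b(proj A)` such that
`End_{D^b(A)}(P)` has infinite global dimension. -/
theorem exists_silting_with_infinite_gldim_end
    (k : Type) [Field k] :
    ∀ n : ℕ, 2 < n → Nonempty (SiltingWitness k n) := by
  intro n hn
  obtain ⟨m, rfl⟩ := Nat.exists_eq_add_of_lt hn
  rw [show 2 + m + 1 = m + 3 by omega]
  exact nonempty_siltingWitness k m

end

end TwoTermSilting
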